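/- arXiv:1611.02732 — 3 statements merged into one kernel-verified Lean document; each statement's English description precedes it below -/
import Mathlib

section
/- Let ρ_r ∈ (0,1] and j ∈ ℝ with j² < (4/27)·ρ_r⁶, and let ρ_j be the unique number in (√(2/3)·ρ_r, ρ_r] with ρ_j⁴·(ρ_r² − ρ_j²) = j². Then there exists σ* > 0 such that for every σ₀ ≥ σ* there exist constants C > 0 and γ > 0 and a unique pair of twice continuously differentiable functions ρ, φ : [0,∞) → ℝ satisfying, for all τ ≥ 0: (i) ρ''(τ) = −(ρ_r² − (σ₀·φ'(τ) − j)²/ρ(τ)⁴ − ρ(τ)²)·ρ(τ); (ii) σ₀·φ''(τ) = ρ(τ)²·φ(τ); (iii) ρ'(0) = 0 and φ'(0) = j/σ₀; (iv) ρ(τ) ≥ ρ_j; (v) ρ − ρ_j, ρ', φ, φ' are all square-integrable on [0,∞); and (vi) |φ(τ)| + |φ'(τ)| + |ρ(τ)² − ρ_j²|^{1/2} + |ρ'(τ)| ≤ C·e^{−γ·σ₀^{−1/2}·τ}. -/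
/-- The inner (boundary-layer) problem on `[0,∞)`: `(ρ, φ)` is twice continuously
differentiable, satisfies the coupled ODE system (i)–(iii), the lower bound
`ρ ≥ ρ_j` (iv), and the square-integrability conditions (v). -/
def InnerSol (ρr j ρj σ₀ : ℝ) (ρ φ : ℝ → ℝ) : Prop :=
  ContDiffOn ℝ 2 ρ (Set.Ici (0 : ℝ)) ∧ ContDiffOn ℝ 2 φ (Set.Ici (0 : ℝ)) ∧
  (∀ τ ≥ (0 : ℝ),
    derivWithin (derivWithin ρ (Set.Ici (0 : ℝ))) (Set.Ici (0 : ℝ)) τ =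
      -(ρr ^ 2 - (σ₀ * derivWithin φ (Set.Ici (0 : ℝ)) τ - j) ^ 2 / (ρ τ) ^ 4 -
          (ρ τ) ^ 2) * ρ τ) ∧
  (∀ τ ≥ (0 : ℝ),
    σ₀ * derivWithin (derivWithin φ (Set.Ici (0 : ℝ))) (Set.Ici (0 : ℝ)) τ =
      (ρ τ) ^ 2 * φ τ) ∧
  derivWithin ρ (Set.Ici (0 : ℝ)) 0 = 0 ∧
  derivWithin φ (Set.Ici (0 : ℝ)) 0 = j / σ₀ ∧
  (∀ τ ≥ (0 : ℝ), ρj ≤ ρ τ) ∧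
  MeasureTheory.IntegrableOn (fun τ => (ρ τ - ρj) ^ 2) (Set.Ici (0 : ℝ)) ∧
  MeasureTheory.IntegrableOn
    (fun τ => (derivWithin ρ (Set.Ici (0 : ℝ)) τ) ^ 2) (Set.Ici (0 : ℝ)) ∧
  MeasureTheory.IntegrableOn (fun τ => (φ τ) ^ 2) (Set.Ici (0 : ℝ)) ∧
  MeasureTheory.IntegrableOn
    (fun τ => (derivWithin φ (Set.Ici (0 : ℝ)) τ) ^ 2) (Set.Ici (0 : ℝ))

namespace InnerProblem

open Set Filter Topology MeasureTheory

/-- `f'` is the (one-sided at `0`) derivative of `f` on `[0,∞)`. -/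
def DerivIci (f f' : ℝ → ℝ) : Prop :=
  ∀ t, 0 ≤ t → HasDerivWithinAt f (f' t) (Ici 0) t

namespace DerivIci

variable {f f' g g' : ℝ → ℝ}

theorem continuousOn (h : DerivIci f f') : ContinuousOn f (Ici 0) :=
  fun t ht => (h t ht).continuousWithinAt

theorem hasDerivAt (h : DerivIci f f') {t : ℝ} (ht : 0 < t) : HasDerivAt f (f' t) t :=
  (h t ht.le).hasDerivAt (Ici_mem_nhds ht)

theorem mul_sub_le (h : DerivIci f f') {a b m : ℝ} (ha : 0 ≤ a) (hab : a ≤ b)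
    (hm : ∀ x, a < x → x < b → m ≤ f' x) : m * (b - a) ≤ f b - f a := by
  refine (convex_Icc a b).mul_sub_le_image_sub_of_le_deriv
    (h.continuousOn.mono fun x hx => ha.trans hx.1) ?_ ?_ a (left_mem_Icc.2 hab) b
    (right_mem_Icc.2 hab) hab
  · rw [interior_Icc]
    exact fun x hx => (h.hasDerivAt (ha.trans_lt hx.1)).differentiableAt.differentiableWithinAt
  · rw [interior_Icc]
    intro x hx
    rw [(h.hasDerivAt (ha.trans_lt hx.1)).deriv]
    exact hm x hx.1 hx.2

theorem neg (h : DerivIci f f') : DerivIci (fun t => -f t) (fun t => -f' t) :=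
  fun t ht => (h t ht).neg

theorem sub (h : DerivIci f f') (h' : DerivIci g g') :
    DerivIci (fun t => f t - g t) (fun t => f' t - g' t) :=
  fun t ht => (h t ht).sub (h' t ht)

theorem sub_const (h : DerivIci f f') (c : ℝ) : DerivIci (fun t => f t - c) f' :=
  fun t ht => (h t ht).sub_const c

theorem const_mul (h : DerivIci f f') (c : ℝ) :
    DerivIci (fun t => c * f t) (fun t => c * f' t) :=
  fun t ht => (h t ht).const_mul c

theorem congr (h : DerivIci f f') (hg : ∀ t, 0 ≤ t → g' t = f' t) : DerivIci f g' :=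
  fun t ht => by rw [hg t ht]; exact h t ht

theorem congr_fun (h : DerivIci f f') (hg : ∀ t, 0 ≤ t → g t = f t) : DerivIci g f' :=
  fun t ht => (h t ht).congr hg (hg t ht)

theorem unique (h : DerivIci f f') (h' : DerivIci f g') {t : ℝ} (ht : 0 ≤ t) : f' t = g' t :=
  (uniqueDiffOn_Ici (0 : ℝ) t ht).eq_deriv _ (h t ht) (h' t ht)

/-- Interpolation bound for the first derivative. -/
theorem abs_deriv_le (h : DerivIci f f') (h' : DerivIci f' g) {t s A B : ℝ} (ht : 0 ≤ t)
    (hs : 0 < s) (hA : ∀ x, t ≤ x → x ≤ t + s → |g x| ≤ A) (hB : |f (t + s) - f t| ≤ B) :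
    |f' t| ≤ B / s + A * s := by
  obtain ⟨x, hx, hfx⟩ := exists_hasDerivAt_eq_slope f f' (lt_add_of_pos_right t hs)
    (h.continuousOn.mono fun x hx => ht.trans hx.1) fun x hx => h.hasDerivAt (ht.trans_lt hx.1)
  have hB' : |f' x| ≤ B / s := by
    rw [hfx, abs_div, add_sub_cancel_left, abs_of_pos hs]
    gcongr
  have hA0 : 0 ≤ A := (abs_nonneg _).trans (hA t le_rfl (by linarith))
  have h1 := h'.mul_sub_le (m := -A) ht hx.1.le fun y hy hy' =>
    (abs_le.1 (hA y hy.le (hy'.le.trans hx.2.le))).1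
  have h2 := h'.neg.mul_sub_le (m := -A) ht hx.1.le fun y hy hy' =>
    neg_le_neg (abs_le.1 (hA y hy.le (hy'.le.trans hx.2.le))).2
  have h3 : A * (x - t) ≤ A * s := by
    have := hx.2
    gcongr
    linarith
  rw [abs_le] at hB' ⊢
  constructor <;> linarith

/-- A maximum principle on the half-line: a function which is strictly convex where it is
positive, satisfies a Dirichlet or Neumann sign condition at `0` and does not tend to infinity
is nonpositive. -/
theorem nonpos {b b₁ b₂ : ℝ → ℝ} (hb : DerivIci b b₁) (hb₁ : DerivIci b₁ b₂)
    (h0 : b 0 ≤ 0 ∨ 0 ≤ b₁ 0) (hpos : ∀ t, 0 ≤ t → 0 < b t → 0 < b₂ t)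
    (hnt : ¬ Tendsto b atTop atTop) {t : ℝ} (ht : 0 ≤ t) : b t ≤ 0 := by
  by_contra! hbt
  obtain ⟨a, ha, hba, hb₁a⟩ : ∃ a, 0 ≤ a ∧ 0 < b a ∧ 0 ≤ b₁ a := by
    by_cases hb0 : b 0 ≤ 0
    · have hK : IsCompact (Icc 0 t ∩ b ⁻¹' Iic 0) :=
        isCompact_Icc.of_isClosed_subset
          ((hb.continuousOn.mono fun x hx => hx.1).preimage_isClosed_of_isClosed isClosed_Icc
            isClosed_Iic) inter_subset_left
      obtain ⟨s, hs, hmax⟩ := hK.exists_isGreatest ⟨0, ⟨le_rfl, ht⟩, hb0⟩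
      have hst : s < t := lt_of_le_of_ne hs.1.2 (by
        rintro rfl
        exact absurd hs.2 (not_le.2 hbt))
      obtain ⟨x, hx, hbx⟩ := exists_hasDerivAt_eq_slope b b₁ hst
        (hb.continuousOn.mono fun x hx => hs.1.1.trans hx.1)
        fun x hx => hb.hasDerivAt (hs.1.1.trans_lt hx.1)
      have hx0 : 0 ≤ x := hs.1.1.trans hx.1.le
      refine ⟨x, hx0, ?_, ?_⟩
      · by_contra! hneg
        exact absurd (hmax ⟨⟨hx0, hx.2.le⟩, hneg⟩) (not_le.2 hx.1)
      · rw [hbx]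
        have : b s ≤ 0 := hs.2
        exact div_nonneg (by linarith) (by linarith)
    · exact ⟨0, le_rfl, not_le.1 hb0, h0.resolve_left hb0⟩
  have key : ∀ x, a ≤ x → b a / 2 < b x := by
    intro x hx
    by_contra! hbx
    have hK : IsCompact (Icc a x ∩ b ⁻¹' Iic (b a / 2)) :=
      isCompact_Icc.of_isClosed_subset
        ((hb.continuousOn.mono fun y hy => ha.trans hy.1).preimage_isClosed_of_isClosed
          isClosed_Icc isClosed_Iic) inter_subset_left
    obtain ⟨s, hs, hmin⟩ := hK.exists_isLeast ⟨x, ⟨hx, le_rfl⟩, hbx⟩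
    have hlt : ∀ y, a ≤ y → y < s → 0 < b y := by
      intro y hy hys
      by_contra! hneg
      exact absurd (hmin ⟨⟨hy, hys.le.trans hs.1.2⟩, hneg.trans (by linarith)⟩) (not_le.2 hys)
    have h1 : ∀ y, a ≤ y → y < s → 0 ≤ b₁ y := by
      intro y hy hys
      have := hb₁.mul_sub_le (m := 0) ha hy fun z hz hz' =>
        (hpos z (ha.trans hz.le) (hlt z hz.le (hz'.trans hys))).le
      linarith
    have h2 := hb.mul_sub_le (m := 0) ha hs.1.1 fun y hy hy' => h1 y hy.le hy'
    have h3 : b s ≤ b a / 2 := hs.2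
    linarith
  have hb₂ : ∀ x, a ≤ x → 0 < b₂ x := fun x hx =>
    hpos x (ha.trans hx) (lt_trans (by linarith) (key x hx))
  have hb₁mono : StrictMonoOn b₁ (Ici a) := by
    refine strictMonoOn_of_deriv_pos (convex_Ici a) (hb₁.continuousOn.mono (Ici_subset_Ici.2 ha)) ?_
    intro x hx
    rw [interior_Ici] at hx
    rw [(hb₁.hasDerivAt (ha.trans_lt hx)).deriv]
    exact hb₂ x (le_of_lt hx)
  have hm : 0 < b₁ (a + 1) :=
    hb₁a.trans_lt (hb₁mono self_mem_Ici (by simp) (by simp))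
  apply hnt
  have hlin : Tendsto (fun x => b (a + 1) + b₁ (a + 1) * (x - (a + 1))) atTop atTop :=
    tendsto_atTop_add_const_left _ _
      ((tendsto_atTop_add_const_right _ (-(a + 1)) tendsto_id).const_mul_atTop hm)
  refine tendsto_atTop_mono' _ ?_ hlin
  filter_upwards [eventually_ge_atTop (a + 1)] with x hx
  have := hb.mul_sub_le (m := b₁ (a + 1)) (by linarith) hx fun y hy hy' =>
    hb₁mono.monotoneOn (by simp) (by simp; linarith) hy.le
  linarith

end DerivIci

theorem not_tendsto_atTop_of_le {b : ℝ → ℝ} {C : ℝ} (h : ∀ t, 0 ≤ t → b t ≤ C) :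
    ¬ Tendsto b atTop atTop := by
  intro ht
  obtain ⟨t, h1, h2⟩ := ((ht.eventually_gt_atTop C).and (eventually_ge_atTop 0)).exists
  exact absurd (h t h2) (not_le.2 h1)

/-- The positive `ρ` with `ρ ^ 3 / 3 = y`. -/
noncomputable def cbrt (y : ℝ) : ℝ := (3 * y) ^ ((1 : ℝ) / 3)

theorem cbrt_pos {y : ℝ} (hy : 0 < y) : 0 < cbrt y := Real.rpow_pos_of_pos (by linarith) _

theorem cbrt_cube {y : ℝ} (hy : 0 ≤ y) : cbrt y ^ 3 = 3 * y := by
  rw [cbrt, ← Real.rpow_natCast, ← Real.rpow_mul (by linarith)]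
  norm_num

theorem cbrt_cube_div {ρ : ℝ} (hρ : 0 ≤ ρ) : cbrt (ρ ^ 3 / 3) = ρ := by
  rw [cbrt, mul_div_cancel₀ _ (by norm_num), ← Real.rpow_natCast, ← Real.rpow_mul hρ]
  norm_num

theorem cbrt_le_cbrt {x y : ℝ} (hx : 0 ≤ x) (hxy : x ≤ y) : cbrt x ≤ cbrt y :=
  Real.rpow_le_rpow (by linarith) (by linarith) (by norm_num)

theorem continuous_cbrt : Continuous cbrt :=
  (continuous_const.mul continuous_id).rpow_const fun _ => Or.inr (by norm_num)

theorem hasDerivAt_cbrt {y : ℝ} (hy : 0 < y) : HasDerivAt cbrt (1 / cbrt y ^ 2) y := by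
  have h := ((hasDerivAt_id y).const_mul 3).rpow_const (p := (1 : ℝ) / 3)
    (Or.inl (by simp only [id]; linarith))
  refine HasDerivAt.congr_deriv (f := cbrt) h ?_
  have h3 : (0 : ℝ) < 3 * y := by linarith
  simp only [id, mul_one]
  rw [cbrt, ← Real.rpow_natCast, ← Real.rpow_mul h3.le, one_div (_ ^ _), ← Real.rpow_neg h3.le]
  norm_num

/-- The right-hand side of the equation for `ρ ^ 3 / 3` in the variable `t = ∫ ρ²`. -/
noncomputable def force (ρr ρ u : ℝ) : ℝ := ρ - ρr ^ 2 / ρ + u ^ 2 / ρ ^ 5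

/-- The derivative of `force` with respect to `ρ ^ 3 / 3`. -/
noncomputable def forceDeriv (ρr ρ u : ℝ) : ℝ :=
  1 / ρ ^ 2 + ρr ^ 2 / ρ ^ 4 - 5 * u ^ 2 / ρ ^ 8

theorem force_path_lt {ρr ρ₁ ρ₂ a p q D : ℝ} (h1 : 0 < ρ₁) (h12 : ρ₁ ≤ ρ₂)
    (hp : p = ρ₂ ^ 3 / 3 - ρ₁ ^ 3 / 3) (hq : 0 ≤ q) (hqa : q ≤ a)
    (hD : ∀ ρ u, ρ₁ ≤ ρ → ρ ≤ ρ₂ → 0 ≤ u → u ≤ a →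
      D < forceDeriv ρr ρ u * p - 2 * u / ρ ^ 5 * q) :
    D < force ρr ρ₂ (a - q) - force ρr ρ₁ a := by
  have hp0 : 0 ≤ p := by
    have := pow_le_pow_left₀ h1.le h12 3
    linarith
  have hy1 : 0 < ρ₁ ^ 3 / 3 := by positivity
  have hder : ∀ s, 0 ≤ s → HasDerivAt
      (fun s => force ρr (cbrt (ρ₁ ^ 3 / 3 + s * p)) (a - s * q))
      (forceDeriv ρr (cbrt (ρ₁ ^ 3 / 3 + s * p)) (a - s * q) * p -
        2 * (a - s * q) / cbrt (ρ₁ ^ 3 / 3 + s * p) ^ 5 * q) s := by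
    intro s hs
    have hpos : 0 < ρ₁ ^ 3 / 3 + s * p := by positivity
    have hr := cbrt_pos hpos
    have hc : HasDerivAt (fun s => cbrt (ρ₁ ^ 3 / 3 + s * p))
        (1 / cbrt (ρ₁ ^ 3 / 3 + s * p) ^ 2 * (1 * p)) s :=
      HasDerivAt.comp (h₂ := cbrt) (h := fun s => ρ₁ ^ 3 / 3 + s * p) s (hasDerivAt_cbrt hpos)
        (((hasDerivAt_id s).mul_const p).const_add _)
    have hu : HasDerivAt (fun s => a - s * q) (-(1 * q)) s :=
      ((hasDerivAt_id s).mul_const q).const_sub a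
    have h := (hc.sub ((hasDerivAt_const s (ρr ^ 2)).div hc hr.ne')).add
      ((hu.pow 2).div (hc.pow 5) (pow_pos hr 5).ne')
    refine HasDerivAt.congr_deriv
      (f := fun s => force ρr (cbrt (ρ₁ ^ 3 / 3 + s * p)) (a - s * q)) h ?_
    simp only [forceDeriv, Pi.pow_apply]
    generalize cbrt (ρ₁ ^ 3 / 3 + s * p) = r at hr
    field_simp
    push_cast
    ring
  obtain ⟨s, hs, hse⟩ := exists_hasDerivAt_eq_slope _ _ (zero_lt_one (α := ℝ))
    (fun s hs => (hder s hs.1).continuousAt.continuousWithinAt) (fun s hs => hder s hs.1.le)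
  have e1 : ρ₁ ^ 3 / 3 + 1 * p = ρ₂ ^ 3 / 3 := by rw [hp]; ring
  have e0 : ρ₁ ^ 3 / 3 + 0 * p = ρ₁ ^ 3 / 3 := by ring
  rw [e1, e0, cbrt_cube_div h1.le, cbrt_cube_div (h1.le.trans h12)] at hse
  simp only [one_mul, zero_mul, sub_zero, div_one] at hse
  rw [← hse]
  apply hD
  · calc ρ₁ = cbrt (ρ₁ ^ 3 / 3) := (cbrt_cube_div h1.le).symm
      _ ≤ _ := cbrt_le_cbrt hy1.le (by have := mul_nonneg hs.1.le hp0; linarith)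
  · calc _ ≤ cbrt (ρ₂ ^ 3 / 3) := by
          refine cbrt_le_cbrt (add_nonneg hy1.le (mul_nonneg hs.1.le hp0)) ?_
          have := mul_le_of_le_one_left hp0 hs.2.le
          linarith
      _ = ρ₂ := cbrt_cube_div (h1.le.trans h12)
  · have := mul_le_of_le_one_left hq hs.2.le
    linarith
  · have := mul_nonneg hs.1.le hq
    linarith

/-- The parameters of the inner problem, with a nonnegative current. -/
structure Params (ρr j ρj : ℝ) : Prop where
  j_nonneg : 0 ≤ j
  pos : 0 < ρj
  le : ρj ≤ ρr
  eq : j ^ 2 = ρj ^ 4 * (ρr ^ 2 - ρj ^ 2)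
  lt : 2 * ρr ^ 2 < 3 * ρj ^ 2

namespace Params

variable {ρr j ρj : ℝ}

theorem pos' (P : Params ρr j ρj) : 0 < ρr := P.pos.trans_le P.le

theorem force_eq_zero (P : Params ρr j ρj) : force ρr ρj j = 0 := by
  have := P.pos
  rw [force, P.eq]
  field_simp
  ring

theorem le_forceDeriv (P : Params ρr j ρj) {ρ u : ℝ} (hρ : ρj ≤ ρ) (hρ' : ρ ≤ ρr) (hu : 0 ≤ u)
    (huj : u ≤ j) : (6 * ρj ^ 2 - 4 * ρr ^ 2) / ρr ^ 4 ≤ forceDeriv ρr ρ u := by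
  have h0 := P.pos
  have h1 : 0 < ρ := h0.trans_le hρ
  have h2 := P.lt
  have h3 : u ^ 2 ≤ ρ ^ 4 * (ρr ^ 2 - ρj ^ 2) := by
    calc u ^ 2 ≤ j ^ 2 := by gcongr
      _ = ρj ^ 4 * (ρr ^ 2 - ρj ^ 2) := P.eq
      _ ≤ _ := by
        have : 0 ≤ ρr ^ 2 - ρj ^ 2 := sub_nonneg.2 (pow_le_pow_left₀ h0.le P.le 2)
        gcongr
  have h4 : ρj ^ 2 ≤ ρ ^ 2 := by gcongr
  calc (6 * ρj ^ 2 - 4 * ρr ^ 2) / ρr ^ 4 ≤ (6 * ρj ^ 2 - 4 * ρr ^ 2) / ρ ^ 4 := by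
        have : 0 ≤ 6 * ρj ^ 2 - 4 * ρr ^ 2 := by linarith
        gcongr
    _ ≤ (ρ ^ 2 + ρr ^ 2 - 5 * (ρr ^ 2 - ρj ^ 2)) / ρ ^ 4 := by
        refine div_le_div_of_nonneg_right ?_ (by positivity)
        linarith
    _ = 1 / ρ ^ 2 + ρr ^ 2 / ρ ^ 4 - 5 * (ρ ^ 4 * (ρr ^ 2 - ρj ^ 2)) / ρ ^ 8 := by
        field_simp
    _ ≤ _ := by
        rw [forceDeriv]
        gcongr

theorem forceRate_pos (P : Params ρr j ρj) : 0 < (6 * ρj ^ 2 - 4 * ρr ^ 2) / ρr ^ 4 := by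
  have := P.lt
  have := P.pos'
  apply div_pos
  · linarith
  · positivity

theorem force_mono_left (P : Params ρr j ρj) {ρ₁ ρ₂ u : ℝ} (h1 : ρj ≤ ρ₁) (h12 : ρ₁ ≤ ρ₂)
    (h2 : ρ₂ ≤ ρr) (hu : 0 ≤ u) (huj : u ≤ j) :
    (6 * ρj ^ 2 - 4 * ρr ^ 2) / ρr ^ 4 * (ρ₂ ^ 3 / 3 - ρ₁ ^ 3 / 3) ≤
      force ρr ρ₂ u - force ρr ρ₁ u := by
  refine le_of_forall_lt fun D hD => ?_
  have h3 : 0 ≤ ρ₂ ^ 3 / 3 - ρ₁ ^ 3 / 3 := by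
    have := pow_le_pow_left₀ (P.pos.le.trans h1) h12 3
    linarith
  have := force_path_lt (ρr := ρr) (D := D) (P.pos.trans_le h1) h12 rfl le_rfl hu ?_
  · rwa [sub_zero] at this
  · intro ρ v hρ hρ' hv hva
    refine hD.trans_le ?_
    rw [mul_zero, sub_zero]
    exact mul_le_mul_of_nonneg_right
      (P.le_forceDeriv (h1.trans hρ) (hρ'.trans h2) hv (hva.trans huj)) h3

/-- The key estimate: the equation for `ρ` dominates the influence of the current. -/
theorem le_forceDeriv_mul (P : Params ρr j ρj) {c ρ u a : ℝ} (hc : j < c)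
    (hρ : ρj ≤ ρ) (hρ' : ρ ≤ ρr) (hcj : 2 * j * c < ρj ^ 6) (hu : 0 ≤ u) (hua : u ≤ a)
    (haj : a ≤ j) :
    (ρj ^ 6 - 2 * j * c) / (ρr ^ 5 * c) ≤
      forceDeriv ρr ρ u * (ρj ^ 3 / 2 / (c - a ^ 2 / j)) - 2 * u / ρ ^ 5 := by
  have h0 := P.pos
  have h1 : 0 < ρ := h0.trans_le hρ
  have h2 : a ^ 2 / j ≤ a := div_le_of_le_mul₀ P.j_nonneg (hu.trans hua) (by nlinarith)
  have h3 : 0 ≤ a ^ 2 / j := div_nonneg (sq_nonneg a) P.j_nonneg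
  set d := c - a ^ 2 / j with hd
  have hd0 : 0 < d := by linarith
  have hdc : d ≤ c := by linarith
  have hjc : 0 < c := P.j_nonneg.trans_lt hc
  have key1 : 5 * u ^ 2 + 4 * u * d ≤ j ^ 2 + 4 * j * c := by
    rcases P.j_nonneg.eq_or_lt with hj | hj
    · have : u = 0 := by linarith
      rw [this, ← hj]
      norm_num
    · have hg : u ^ 2 / j ≤ a ^ 2 / j := by gcongr
      have hud : u * d ≤ u * (c - u ^ 2 / j) := by gcongr; linarith
      obtain ⟨t, rfl⟩ : ∃ t, u = t * j := ⟨u / j, by field_simp⟩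
      have ht : 0 ≤ t := by
        by_contra! h
        nlinarith
      have ht1 : t ≤ 1 := by
        by_contra! h
        nlinarith
      have e : t * j * (c - (t * j) ^ 2 / j) = t * j * c - t ^ 3 * j ^ 2 := by field_simp
      rw [e] at hud
      have h5 : 0 ≤ (1 - t) * j * (4 * (c - j) + j * (1 - t) * (4 * t + 5)) := by
        have : 0 ≤ c - j := by linarith
        have : 0 ≤ 1 - t := by linarith
        positivity
      nlinarith
  have key2 : 2 * (ρj ^ 6 - 2 * j * c) ≤ ρj ^ 6 + ρr ^ 2 * ρj ^ 4 - 5 * u ^ 2 - 4 * u * d := by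
    have := P.eq
    nlinarith
  have key3 : ρ ^ 3 * (ρj ^ 6 + ρr ^ 2 * ρj ^ 4 - 5 * u ^ 2) ≤
      ρj ^ 3 * (ρ ^ 6 + ρr ^ 2 * ρ ^ 4 - 5 * u ^ 2) := by
    have e1 : ρj ^ 3 ≤ ρ ^ 3 := by gcongr
    have e2 : 0 ≤ ρ ^ 3 * ρj ^ 3 * (ρ ^ 3 - ρj ^ 3) := by
      have : 0 ≤ ρ ^ 3 - ρj ^ 3 := by linarith
      positivity
    have e3 : 0 ≤ ρr ^ 2 * ρ ^ 3 * ρj ^ 3 * (ρ - ρj) := by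
      have : 0 ≤ ρ - ρj := by linarith
      positivity
    have e4 : 0 ≤ u ^ 2 * (ρ ^ 3 - ρj ^ 3) := mul_nonneg (sq_nonneg u) (by linarith)
    nlinarith
  calc (ρj ^ 6 - 2 * j * c) / (ρr ^ 5 * c) ≤ (ρj ^ 6 - 2 * j * c) / (ρ ^ 5 * d) := by
        have : 0 ≤ ρj ^ 6 - 2 * j * c := by linarith
        have : 0 < ρr := P.pos'
        gcongr
    _ = ρ ^ 3 * (2 * (ρj ^ 6 - 2 * j * c)) / (2 * (ρ ^ 8 * d)) := by field_simp
    _ ≤ ρ ^ 3 * (ρj ^ 6 + ρr ^ 2 * ρj ^ 4 - 5 * u ^ 2 - 4 * u * d) / (2 * (ρ ^ 8 * d)) := by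
        gcongr
    _ ≤ (ρj ^ 3 * (ρ ^ 6 + ρr ^ 2 * ρ ^ 4 - 5 * u ^ 2) - 4 * u * d * ρ ^ 3) /
        (2 * (ρ ^ 8 * d)) := by
        gcongr
        linarith
    _ = _ := by
        rw [forceDeriv]
        field_simp
        ring

theorem lt_force_sub (P : Params ρr j ρj) {c ρ₁ ρ₂ a M q : ℝ} (hc : j < c)
    (hcj : 2 * j * c < ρj ^ 6) (h1 : ρj ≤ ρ₁) (h2 : ρ₂ ≤ ρr) (haj : a ≤ j)
    (hq : 0 ≤ q) (hqa : q ≤ a) (hqM : q ≤ M)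
    (hp : ρj ^ 3 / 2 * M / (c - a ^ 2 / j) < ρ₂ ^ 3 / 3 - ρ₁ ^ 3 / 3) :
    (ρj ^ 6 - 2 * j * c) / (ρr ^ 5 * c) * M < force ρr ρ₂ (a - q) - force ρr ρ₁ a := by
  have h0 := P.pos
  have hρ₁ : 0 < ρ₁ := h0.trans_le h1
  have hM : 0 ≤ M := hq.trans hqM
  have hd0 : 0 < c - a ^ 2 / j := by
    have : a ^ 2 / j ≤ a := div_le_of_le_mul₀ P.j_nonneg (hq.trans hqa) (by nlinarith)
    linarith
  have hp0 : 0 < ρ₂ ^ 3 / 3 - ρ₁ ^ 3 / 3 := lt_of_le_of_lt (by positivity) hp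
  have h12 : ρ₁ ≤ ρ₂ := by
    by_contra! h
    have h1 := pow_pos hρ₁ 3
    have h2 : 0 ≤ ρ₂ := by
      by_contra! hn
      have := Odd.pow_nonpos (n := 3) (by decide) hn.le
      linarith
    have := pow_lt_pow_left₀ h h2 three_ne_zero
    linarith
  refine force_path_lt hρ₁ h12 rfl hq hqa fun ρ u hρ hρ' hu hua => ?_
  have hρ0 : 0 < ρ := hρ₁.trans_le hρ
  have k1 := P.le_forceDeriv_mul hc (h1.trans hρ) (hρ'.trans h2) hcj hu hua haj
  have k2 := P.forceRate_pos.trans_le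
    (P.le_forceDeriv (h1.trans hρ) (hρ'.trans h2) hu (hua.trans haj))
  have k3 := mul_le_mul_of_nonneg_right k1 hM
  have k4 := mul_lt_mul_of_pos_left hp k2
  have k5 : 2 * u / ρ ^ 5 * q ≤ 2 * u / ρ ^ 5 * M := by gcongr
  have e : ρj ^ 3 / 2 * M / (c - a ^ 2 / j) = ρj ^ 3 / 2 / (c - a ^ 2 / j) * M := by ring
  rw [e] at k4
  linarith

end Params

/-- The inner problem in the variable `t = ∫ ρ²`, with `v = -σ φ'` and `π = (ρ ^ 3 / 3)'`. -/
structure Profile (ρr j ρj σ : ℝ) (v ρ φ π : ℝ → ℝ) : Prop where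
  deriv_v : DerivIci v fun t => -φ t
  deriv_φ : DerivIci φ fun t => -v t / (σ * ρ t ^ 2)
  deriv_y : DerivIci (fun t => ρ t ^ 3 / 3) π
  deriv_π : DerivIci π fun t => force ρr (ρ t) (j + v t)
  v_zero : v 0 = -j
  π_zero : π 0 = 0
  v_ge : ∀ t, 0 ≤ t → -j ≤ v t
  v_le : ∀ t, 0 ≤ t → v t ≤ 0
  ρ_ge : ∀ t, 0 ≤ t → ρj ≤ ρ t
  ρ_le : ∀ t, 0 ≤ t → ρ t ≤ ρr

theorem sq_sub_sq_le {x y z A : ℝ} (hz : 0 < z) (hzx : z ≤ x) (hA : 0 ≤ A) (hy : 0 ≤ y)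
    (h : y ^ 3 / 3 - x ^ 3 / 3 ≤ z ^ 3 / 2 * A) : y ^ 2 - x ^ 2 ≤ z ^ 2 * A := by
  have hx : 0 < x := hz.trans_le hzx
  rcases le_total y x with hyx | hxy
  · have : y ^ 2 ≤ x ^ 2 := by gcongr
    have : 0 ≤ z ^ 2 * A := by positivity
    linarith
  · have h1 : (y ^ 2 - x ^ 2) * (x / 2) ≤ y ^ 3 / 3 - x ^ 3 / 3 := by
      have : 0 ≤ (y - x) ^ 2 * (2 * y + x) := by positivity
      nlinarith
    have h2 : (y ^ 2 - x ^ 2) * (z / 2) ≤ (y ^ 2 - x ^ 2) * (x / 2) := by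
      have : x ^ 2 ≤ y ^ 2 := by gcongr
      have : 0 ≤ y ^ 2 - x ^ 2 := by linarith
      gcongr
    have h3 : (y ^ 2 - x ^ 2) * (z / 2) ≤ z ^ 2 * A * (z / 2) := by
      calc _ ≤ z ^ 3 / 2 * A := (h2.trans h1).trans h
        _ = _ := by ring
    exact le_of_mul_le_mul_right h3 (by positivity)

/-- The conductivity beyond which the comparison argument works, for an auxiliary constant `c`
slightly larger than the current `j`. -/
noncomputable def sigmaStar (ρr j ρj c : ℝ) : ℝ :=
  1 + ρj ^ 3 / 2 * ((8 * j / (c - j) ^ 2 + 32 * j ^ 2 / (c - j) ^ 3) / ρj ^ 2) /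
    ((ρj ^ 6 - 2 * j * c) / (ρr ^ 5 * c))

namespace Profile

variable {ρr j ρj σ : ℝ} {v ρ φ π v₁ ρ₁ φ₁ π₁ v₂ ρ₂ φ₂ π₂ : ℝ → ℝ}

theorem φ_sq_le (P : Params ρr j ρj) (hσ : 0 < σ) (S : Profile ρr j ρj σ v ρ φ π) {t : ℝ}
    (ht : 0 ≤ t) : φ t ^ 2 ≤ 4 * j ^ 2 / (σ * ρj ^ 2) := by
  have h0 := P.pos
  have hj := P.j_nonneg
  set κ := (Real.sqrt (σ * ρj ^ 2))⁻¹ with hκ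
  have hκ0 : 0 < κ := by positivity
  have hκ2 : κ ^ 2 = 1 / (σ * ρj ^ 2) := by
    rw [hκ, inv_pow, Real.sq_sqrt (by positivity), one_div]
  have h := S.deriv_v.abs_deriv_le S.deriv_φ.neg ht (inv_pos.2 hκ0) (A := κ ^ 2 * j) (B := j) ?_ ?_
  · rw [abs_neg] at h
    calc φ t ^ 2 = |φ t| ^ 2 := (sq_abs _).symm
      _ ≤ (j / κ⁻¹ + κ ^ 2 * j * κ⁻¹) ^ 2 := by gcongr
      _ = 4 * j ^ 2 * κ ^ 2 := by field_simp; ring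
      _ = _ := by rw [hκ2]; ring
  · intro x hx _
    have hx0 := ht.trans hx
    rw [abs_neg, abs_div, abs_neg, abs_of_nonpos (S.v_le x hx0), abs_of_pos, hκ2,
      one_div_mul_eq_div]
    · have h1 := S.ρ_ge x hx0
      have h2 := S.v_ge x hx0
      gcongr
      linarith
    · have := h0.trans_le (S.ρ_ge x hx0)
      positivity
  · have hx0 : 0 ≤ t + κ⁻¹ := by positivity
    have h1 := S.v_ge t ht
    have h2 := S.v_le t ht
    have h3 := S.v_ge _ hx0
    have h4 := S.v_le _ hx0
    rw [abs_le]
    constructor <;> linarith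

theorem div_le (P : Params ρr j ρj) (S : Profile ρr j ρj σ v ρ φ π) {t : ℝ} (ht : 0 ≤ t) :
    (j + v t) ^ 2 / j ≤ j + v t := by
  have h1 := S.v_ge t ht
  have h2 := S.v_le t ht
  exact div_le_of_le_mul₀ P.j_nonneg (by linarith) (by nlinarith)

theorem y_sub_le (P : Params ρr j ρj) {c : ℝ} (hc : j < c) (hcj : 2 * j * c < ρj ^ 6)
    (hσ : sigmaStar ρr j ρj c ≤ σ) (S₁ : Profile ρr j ρj σ v₁ ρ₁ φ₁ π₁)
    (S₂ : Profile ρr j ρj σ v₂ ρ₂ φ₂ π₂) {M : ℝ} (hM : 0 ≤ M)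
    (hv : ∀ t, 0 ≤ t → v₁ t - v₂ t ≤ M) {t : ℝ} (ht : 0 ≤ t) :
    ρ₂ t ^ 3 / 3 - ρ₁ t ^ 3 / 3 ≤ ρj ^ 3 / 2 * (M / (c - (j + v₁ t) ^ 2 / j)) := by
  have h0 := P.pos
  have hr := P.pos'
  have hj := P.j_nonneg
  have hc0 : 0 < c := hj.trans_lt hc
  have hcj' : 0 < c - j := sub_pos.2 hc
  have hμ : 0 < (ρj ^ 6 - 2 * j * c) / (ρr ^ 5 * c) := div_pos (by linarith) (by positivity)
  have hσ1 : 1 ≤ σ := by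
    refine le_trans ?_ hσ
    rw [sigmaStar]
    have : 0 ≤ ρj ^ 3 / 2 * ((8 * j / (c - j) ^ 2 + 32 * j ^ 2 / (c - j) ^ 3) / ρj ^ 2) /
      ((ρj ^ 6 - 2 * j * c) / (ρr ^ 5 * c)) := by positivity
    linarith
  have hσ0 : 0 < σ := by linarith
  set g : ℝ → ℝ := fun t => c - (j + v₁ t) ^ 2 / j with hg
  have hgpos : ∀ t, 0 ≤ t → c - j ≤ g t := fun t ht => by
    have := S₁.div_le P ht
    have := S₁.v_le t ht
    simp only [hg]
    linarith
  have hgpos' : ∀ t, 0 ≤ t → 0 < g t := fun t ht => hcj'.trans_le (hgpos t ht)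
  have dg : DerivIci g fun t => 2 * (j + v₁ t) * φ₁ t / j := fun t ht => by
    refine (((((S₁.deriv_v t ht).const_add j).pow 2).div_const j).const_sub c).congr_deriv ?_
    push_cast
    ring
  have dk : DerivIci (fun t => (g t)⁻¹) fun t => -(2 * (j + v₁ t) * φ₁ t / j) / g t ^ 2 :=
    fun t ht => (dg t ht).inv (hgpos' t ht).ne'
  have dk' : DerivIci (fun t => -(2 * (j + v₁ t) * φ₁ t / j) / g t ^ 2) fun t =>
      (2 / j * φ₁ t ^ 2 + 2 * (j + v₁ t) * v₁ t / (j * (σ * ρ₁ t ^ 2))) / g t ^ 2 +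
        8 * ((j + v₁ t) / j) ^ 2 * φ₁ t ^ 2 / g t ^ 3 := fun t ht => by
    have hg0 := hgpos' t ht
    have h1 := ((((S₁.deriv_v t ht).const_add j).const_mul 2).mul (S₁.deriv_φ t ht)).div_const j
    refine (h1.neg.div ((dg t ht).pow 2) (pow_pos hg0 2).ne').congr_deriv ?_
    have hρ := h0.trans_le (S₁.ρ_ge t ht)
    simp only [Pi.pow_apply, Pi.mul_apply, Pi.neg_apply]
    generalize g t = G at hg0
    rcases hj.eq_or_lt with rfl | hj
    · simp
    · push_cast
      field_simp
      ring
  have dy := (S₂.deriv_y.sub S₁.deriv_y).sub (dk.const_mul (ρj ^ 3 / 2 * M))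
  have dy' := (S₂.deriv_π.sub S₁.deriv_π).sub (dk'.const_mul (ρj ^ 3 / 2 * M))
  have hmain := dy.nonpos dy' ?_ ?_ ?_ ht
  · have e : ρj ^ 3 / 2 * (M / (c - (j + v₁ t) ^ 2 / j)) = ρj ^ 3 / 2 * M * (g t)⁻¹ := by
      rw [mul_assoc, ← div_eq_mul_inv]
    rw [e]
    linarith
  · right
    simp [S₁.π_zero, S₂.π_zero, S₁.v_zero]
  · intro t ht hpos
    have hg0 := hgpos' t ht
    have a1 := S₁.v_ge t ht
    have a2 := S₁.v_le t ht
    have a3 := S₂.v_ge t ht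
    have a4 := S₂.v_le t ht
    have a5 := hv t ht
    have hρ₂ : 0 < ρ₂ t := h0.trans_le (S₂.ρ_ge t ht)
    have hlt := P.lt_force_sub (M := M) (q := min M (j + v₁ t)) (a := j + v₁ t) hc hcj
      (S₁.ρ_ge t ht) (S₂.ρ_le t ht) (by linarith) (le_min hM (by linarith)) (min_le_right _ _)
      (min_le_left _ _) (by
        have e : ρj ^ 3 / 2 * M / (c - (j + v₁ t) ^ 2 / j) = ρj ^ 3 / 2 * M * (g t)⁻¹ := by
          rw [← div_eq_mul_inv]
        rw [e]
        linarith)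
    have hle : force ρr (ρ₂ t) (j + v₁ t - min M (j + v₁ t)) ≤ force ρr (ρ₂ t) (j + v₂ t) := by
      have h1 : 0 ≤ j + v₁ t - min M (j + v₁ t) := sub_nonneg.2 (min_le_right _ _)
      have h2 : j + v₁ t - min M (j + v₁ t) ≤ j + v₂ t := by
        rcases min_cases M (j + v₁ t) with h | h <;> linarith [h.1]
      rw [force, force]
      gcongr
    have hk : ρj ^ 3 / 2 * ((2 / j * φ₁ t ^ 2 + 2 * (j + v₁ t) * v₁ t / (j * (σ * ρ₁ t ^ 2))) /
        g t ^ 2 + 8 * ((j + v₁ t) / j) ^ 2 * φ₁ t ^ 2 / g t ^ 3) ≤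
        (ρj ^ 6 - 2 * j * c) / (ρr ^ 5 * c) := by
      have b1 : 2 * (j + v₁ t) * v₁ t / (j * (σ * ρ₁ t ^ 2)) ≤ 0 :=
        div_nonpos_of_nonpos_of_nonneg
          (mul_nonpos_of_nonneg_of_nonpos (by linarith) a2) (by positivity)
      have b2 := S₁.φ_sq_le P hσ0 ht
      have b3 : ((j + v₁ t) / j) ^ 2 ≤ 1 := by
        refine pow_le_one₀ (div_nonneg (by linarith) hj) (div_le_one_of_le₀ (by linarith) hj)
      have b4 : 2 / j * φ₁ t ^ 2 ≤ 2 / j * (4 * j ^ 2 / (σ * ρj ^ 2)) := by gcongr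
      have b5 : 2 / j * (4 * j ^ 2 / (σ * ρj ^ 2)) = 8 * j / (σ * ρj ^ 2) := by
        rcases hj.eq_or_lt with rfl | hj
        · simp
        · field_simp
          ring
      have hgc := hgpos t ht
      have b6 : (2 / j * φ₁ t ^ 2 + 2 * (j + v₁ t) * v₁ t / (j * (σ * ρ₁ t ^ 2))) / g t ^ 2 ≤
          8 * j / (σ * ρj ^ 2) / (c - j) ^ 2 := by
        calc _ ≤ 8 * j / (σ * ρj ^ 2) / g t ^ 2 := by
              refine div_le_div_of_nonneg_right ?_ (by positivity)
              linarith
          _ ≤ _ := by gcongr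
      have b7 : 8 * ((j + v₁ t) / j) ^ 2 * φ₁ t ^ 2 / g t ^ 3 ≤
          8 * 1 * (4 * j ^ 2 / (σ * ρj ^ 2)) / (c - j) ^ 3 := by gcongr
      have b8 := add_le_add b6 b7
      have b9 : 8 * j / (σ * ρj ^ 2) / (c - j) ^ 2 +
          8 * 1 * (4 * j ^ 2 / (σ * ρj ^ 2)) / (c - j) ^ 3 =
          (8 * j / (c - j) ^ 2 + 32 * j ^ 2 / (c - j) ^ 3) / ρj ^ 2 / σ := by
        field_simp
        ring
      rw [b9] at b8
      have b10 := mul_le_mul_of_nonneg_left b8 (by positivity : 0 ≤ ρj ^ 3 / 2)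
      refine b10.trans ?_
      rw [← mul_div_assoc, div_le_iff₀ hσ0, mul_comm _ σ, ← div_le_iff₀ hμ]
      rw [sigmaStar] at hσ
      linarith
    have hk' := mul_le_mul_of_nonneg_right hk hM
    have e : ∀ x, ρj ^ 3 / 2 * M * x = ρj ^ 3 / 2 * x * M := fun x => by ring
    rw [e]
    linarith
  · refine not_tendsto_atTop_of_le (C := ρr ^ 3 / 3) fun t ht => ?_
    have hg0 := hgpos' t ht
    have : 0 ≤ ρj ^ 3 / 2 * M * (g t)⁻¹ := by positivity
    have h2 := S₂.ρ_ge t ht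
    have h3 := S₂.ρ_le t ht
    have h1 : 0 < ρ₁ t := h0.trans_le (S₁.ρ_ge t ht)
    have : ρ₂ t ^ 3 ≤ ρr ^ 3 := pow_le_pow_left₀ (h0.le.trans h2) h3 3
    have : 0 < ρ₁ t ^ 3 := by positivity
    linarith

theorem v_sub_le_mul (P : Params ρr j ρj) {c : ℝ} (hc : j < c) (hcj : 2 * j * c < ρj ^ 6)
    (hσ0 : 0 < σ) (hσ : sigmaStar ρr j ρj c ≤ σ) (S₁ : Profile ρr j ρj σ v₁ ρ₁ φ₁ π₁)
    (S₂ : Profile ρr j ρj σ v₂ ρ₂ φ₂ π₂) {M : ℝ} (hM : 0 ≤ M)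
    (hv : ∀ t, 0 ≤ t → v₁ t - v₂ t ≤ M) {t : ℝ} (ht : 0 ≤ t) : v₁ t - v₂ t ≤ j / c * M := by
  have h0 := P.pos
  have hj := P.j_nonneg
  have hc0 : 0 < c := hj.trans_lt hc
  have dv := (S₁.deriv_v.sub S₂.deriv_v).sub_const (j / c * M)
  have dφ := S₁.deriv_φ.neg.sub S₂.deriv_φ.neg
  have := dv.nonpos dφ ?_ ?_ ?_ ht
  · linarith
  · left
    rw [S₁.v_zero, S₂.v_zero]
    have : 0 ≤ j / c * M := by positivity
    linarith
  · intro t ht hpos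
    have a1 := S₁.v_ge t ht
    have a2 := S₁.v_le t ht
    have hρ₁ : 0 < ρ₁ t := h0.trans_le (S₁.ρ_ge t ht)
    have hρ₂ : 0 < ρ₂ t := h0.trans_le (S₂.ρ_ge t ht)
    have hdiv := S₁.div_le P ht
    have hd : 0 < c - (j + v₁ t) ^ 2 / j := by linarith
    have hsq := sq_sub_sq_le h0 (S₁.ρ_ge t ht) (by positivity) hρ₂.le
      (y_sub_le P hc hcj hσ S₁ S₂ hM hv ht)
    have k1 : -v₁ t * (M / (c - (j + v₁ t) ^ 2 / j)) ≤ j / c * M := by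
      rw [← mul_div_assoc, div_le_iff₀ hd]
      have : -v₁ t * c ≤ j * (c - (j + v₁ t) ^ 2 / j) := by
        nlinarith
      calc -v₁ t * M = -v₁ t * c * (M / c) := by field_simp
        _ ≤ j * (c - (j + v₁ t) ^ 2 / j) * (M / c) := by gcongr
        _ = _ := by field_simp
    have k2 : -v₁ t * (ρ₂ t ^ 2 - ρ₁ t ^ 2) < ρ₁ t ^ 2 * (v₁ t - v₂ t) := by
      calc -v₁ t * (ρ₂ t ^ 2 - ρ₁ t ^ 2)
          ≤ -v₁ t * (ρj ^ 2 * (M / (c - (j + v₁ t) ^ 2 / j))) :=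
            mul_le_mul_of_nonneg_left hsq (by linarith)
        _ = ρj ^ 2 * (-v₁ t * (M / (c - (j + v₁ t) ^ 2 / j))) := by ring
        _ ≤ ρj ^ 2 * (j / c * M) := by gcongr
        _ < ρj ^ 2 * (v₁ t - v₂ t) := by
            have : j / c * M < v₁ t - v₂ t := by linarith
            gcongr
        _ ≤ ρ₁ t ^ 2 * (v₁ t - v₂ t) := by
            have : 0 ≤ j / c * M := by positivity
            have : 0 ≤ v₁ t - v₂ t := by linarith
            have := S₁.ρ_ge t ht
            gcongr
    have e : -(-v₁ t / (σ * ρ₁ t ^ 2)) - -(-v₂ t / (σ * ρ₂ t ^ 2)) =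
        (ρ₁ t ^ 2 * (v₁ t - v₂ t) - -v₁ t * (ρ₂ t ^ 2 - ρ₁ t ^ 2)) /
          (σ * ρ₁ t ^ 2 * ρ₂ t ^ 2) := by
      field_simp
      ring
    rw [e]
    exact div_pos (by linarith) (by positivity)
  · refine not_tendsto_atTop_of_le (C := M) fun t ht => ?_
    have := hv t ht
    have : 0 ≤ j / c * M := by positivity
    linarith

theorem v_le_v (P : Params ρr j ρj) {c : ℝ} (hc : j < c) (hcj : 2 * j * c < ρj ^ 6)
    (hσ0 : 0 < σ) (hσ : sigmaStar ρr j ρj c ≤ σ) (S₁ : Profile ρr j ρj σ v₁ ρ₁ φ₁ π₁)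
    (S₂ : Profile ρr j ρj σ v₂ ρ₂ φ₂ π₂) {t : ℝ} (ht : 0 ≤ t) : v₁ t ≤ v₂ t := by
  have hj := P.j_nonneg
  have hc0 : 0 < c := hj.trans_lt hc
  have key : ∀ n : ℕ, ∀ t, 0 ≤ t → v₁ t - v₂ t ≤ (j / c) ^ n * j := by
    intro n
    induction n with
    | zero =>
      intro t ht
      have := S₁.v_le t ht
      have := S₂.v_ge t ht
      simp only [pow_zero, one_mul]
      linarith
    | succ n ih =>
      intro t ht
      rw [pow_succ', mul_assoc]
      exact v_sub_le_mul P hc hcj hσ0 hσ S₁ S₂ (by positivity) ih ht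
  have hlim : Tendsto (fun n : ℕ => (j / c) ^ n * j) atTop (𝓝 (0 * j)) :=
    (tendsto_pow_atTop_nhds_zero_of_lt_one (by positivity) ((div_lt_one hc0).2 hc)).mul_const j
  have := ge_of_tendsto' hlim fun n => key n t ht
  linarith

theorem unique (P : Params ρr j ρj) {c : ℝ} (hc : j < c) (hcj : 2 * j * c < ρj ^ 6)
    (hσ0 : 0 < σ) (hσ : sigmaStar ρr j ρj c ≤ σ) (S₁ : Profile ρr j ρj σ v₁ ρ₁ φ₁ π₁)
    (S₂ : Profile ρr j ρj σ v₂ ρ₂ φ₂ π₂) {t : ℝ} (ht : 0 ≤ t) :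
    v₁ t = v₂ t ∧ ρ₁ t = ρ₂ t := by
  have hv : ∀ t, 0 ≤ t → v₁ t = v₂ t := fun t ht =>
    (v_le_v P hc hcj hσ0 hσ S₁ S₂ ht).antisymm (v_le_v P hc hcj hσ0 hσ S₂ S₁ ht)
  have h1 := y_sub_le P hc hcj hσ S₁ S₂ le_rfl (fun t ht => (sub_nonpos.2 (hv t ht).le)) ht
  have h2 := y_sub_le P hc hcj hσ S₂ S₁ le_rfl (fun t ht => (sub_nonpos.2 (hv t ht).ge)) ht
  rw [zero_div, mul_zero] at h1 h2
  have h0 := P.pos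
  refine ⟨hv t ht, ?_⟩
  have hρ₁ : 0 ≤ ρ₁ t := h0.le.trans (S₁.ρ_ge t ht)
  have hρ₂ : 0 ≤ ρ₂ t := h0.le.trans (S₂.ρ_ge t ht)
  exact (pow_left_inj₀ hρ₁ hρ₂ three_ne_zero).1 (by linarith)

end Profile

/-- A bounded solution `z` of `z'' = k² z - g` on the half-line, with derivative `z'`. -/
structure BddSol (k : ℝ) (g z z' : ℝ → ℝ) : Prop where
  deriv : DerivIci z z'
  deriv' : DerivIci z' fun t => k ^ 2 * z t - g t
  bdd : ∃ C, ∀ t, 0 ≤ t → |z t| ≤ C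

namespace BddSol

variable {k : ℝ} {g z z' g₁ g₂ z₁ z₂ z₁' z₂' : ℝ → ℝ}

theorem const (k c : ℝ) : BddSol k (fun _ => k ^ 2 * c) (fun _ => c) fun _ => 0 where
  deriv t _ := hasDerivWithinAt_const t _ c
  deriv' t _ := (hasDerivWithinAt_const t _ 0).congr_deriv (sub_self _).symm
  bdd := ⟨|c|, fun _ _ => le_rfl⟩

theorem le (hk : 0 < k) (S₁ : BddSol k g₁ z₁ z₁') (S₂ : BddSol k g₂ z₂ z₂')
    (h0 : z₁ 0 ≤ z₂ 0 ∨ z₂' 0 ≤ z₁' 0) (hg : ∀ t, 0 ≤ t → g₁ t ≤ g₂ t) {t : ℝ} (ht : 0 ≤ t) :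
    z₁ t ≤ z₂ t := by
  refine sub_nonpos.1 ((S₁.deriv.sub S₂.deriv).nonpos (S₁.deriv'.sub S₂.deriv')
    (h0.imp sub_nonpos.2 sub_nonneg.2) (fun s hs hb => ?_) ?_ ht)
  · have h1 := hg s hs
    have h2 := mul_pos (pow_pos hk 2) hb
    linarith
  · obtain ⟨C₁, h₁⟩ := S₁.bdd
    obtain ⟨C₂, h₂⟩ := S₂.bdd
    exact not_tendsto_atTop_of_le (C := C₁ + C₂) fun s hs => by
      have := (abs_le.1 (h₁ s hs)).2
      have := (abs_le.1 (h₂ s hs)).1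
      linarith

end BddSol

/-- The Laplace transform `∫₀^∞ e^{-ks} g(s) ds`. -/
noncomputable def laplace (k : ℝ) (g : ℝ → ℝ) : ℝ := ∫ s in Ioi 0, Real.exp (-(k * s)) * g s

/-- The solution of `z'' = k² z - g` on the half-line with `2 k z(0) = α + (1 + β) laplace k g` and
`2 z'(0) = (1 - β) laplace k g - α`. -/
noncomputable def green (k α β : ℝ) (g : ℝ → ℝ) (t : ℝ) : ℝ :=
  (Real.exp (-(k * t)) * ((∫ s in 0..t, Real.exp (k * s) * g s) + (α + β * laplace k g)) +
    Real.exp (k * t) * (laplace k g - ∫ s in 0..t, Real.exp (-(k * s)) * g s)) / (2 * k)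

/-- The derivative of `green`. -/
noncomputable def greenDeriv (k α β : ℝ) (g : ℝ → ℝ) (t : ℝ) : ℝ :=
  (Real.exp (k * t) * (laplace k g - ∫ s in 0..t, Real.exp (-(k * s)) * g s) -
    Real.exp (-(k * t)) * ((∫ s in 0..t, Real.exp (k * s) * g s) + (α + β * laplace k g))) / 2

theorem green_zero (k α β : ℝ) (g : ℝ → ℝ) :
    green k α β g 0 = (α + (1 + β) * laplace k g) / (2 * k) := by
  simp [green]
  ring

theorem greenDeriv_zero (k α β : ℝ) (g : ℝ → ℝ) :
    greenDeriv k α β g 0 = ((1 - β) * laplace k g - α) / 2 := by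
  simp [greenDeriv]
  ring

theorem hasDerivAt_exp_const_mul (k t : ℝ) :
    HasDerivAt (fun t => Real.exp (k * t)) (k * Real.exp (k * t)) t := by
  simpa [mul_comm] using ((hasDerivAt_id t).const_mul k).exp

theorem hasDerivAt_exp_neg_const_mul (k t : ℝ) :
    HasDerivAt (fun t => Real.exp (-(k * t))) (-(k * Real.exp (-(k * t)))) t := by
  simpa [mul_comm] using ((hasDerivAt_id t).const_mul k).neg.exp

section

variable {k α β M : ℝ} {g : ℝ → ℝ}

theorem hasDerivAt_green (hk : 0 < k) (hg : Continuous g) (t : ℝ) :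
    HasDerivAt (green k α β g) (greenDeriv k α β g t) t := by
  have c1 : Continuous fun s => Real.exp (k * s) * g s := by fun_prop
  have c2 : Continuous fun s => Real.exp (-(k * s)) * g s := by fun_prop
  have h1 := (c1.integral_hasStrictDerivAt 0 t).hasDerivAt
  have h2 := (c2.integral_hasStrictDerivAt 0 t).hasDerivAt
  refine ((((hasDerivAt_exp_neg_const_mul k t).mul (h1.add_const (α + β * laplace k g))).add
    ((hasDerivAt_exp_const_mul k t).mul (h2.const_sub (laplace k g)))).div_const
      (2 * k)).congr_deriv ?_
  rw [greenDeriv]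
  field_simp
  ring

theorem hasDerivAt_greenDeriv (hg : Continuous g) (t : ℝ) :
    HasDerivAt (greenDeriv k α β g) (k ^ 2 * green k α β g t - g t) t := by
  have c1 : Continuous fun s => Real.exp (k * s) * g s := by fun_prop
  have c2 : Continuous fun s => Real.exp (-(k * s)) * g s := by fun_prop
  have h1 := (c1.integral_hasStrictDerivAt 0 t).hasDerivAt
  have h2 := (c2.integral_hasStrictDerivAt 0 t).hasDerivAt
  refine ((((hasDerivAt_exp_const_mul k t).mul (h2.const_sub (laplace k g))).sub
    ((hasDerivAt_exp_neg_const_mul k t).mul (h1.add_const (α + β * laplace k g)))).div_const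
      2).congr_deriv ?_
  have e : Real.exp (k * t) * Real.exp (-(k * t)) = 1 := by
    rw [← Real.exp_add, add_neg_cancel, Real.exp_zero]
  rw [green]
  field_simp
  linear_combination (-2 * g t) * e

theorem continuous_green (hg : Measurable g) (hM : ∀ t, |g t| ≤ M) :
    Continuous (green k α β g) := by
  have hI : ∀ h : ℝ → ℝ, Continuous h → ∀ a b, IntervalIntegrable (fun s => h s * g s) volume a b :=
    fun h hh a b => ((hh.abs.intervalIntegrable a b).mul_const M).mono_fun'
      (hh.measurable.mul hg).aestronglyMeasurable <| Eventually.of_forall fun s => by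
        simp only [norm_mul, Real.norm_eq_abs]
        gcongr
        exact hM s
  have c1 := intervalIntegral.continuous_primitive (hI (fun s => Real.exp (k * s)) (by fun_prop)) 0
  have c2 := intervalIntegral.continuous_primitive
    (hI (fun s => Real.exp (-(k * s))) (by fun_prop)) 0
  unfold green
  fun_prop

theorem bddSol_green (hk : 0 < k) (hg : Continuous g) (hM : ∀ t, |g t| ≤ M) :
    BddSol k g (green k α β g) (greenDeriv k α β g) where
  deriv t _ := (hasDerivAt_green hk hg t).hasDerivWithinAt
  deriv' t _ := (hasDerivAt_greenDeriv hg t).hasDerivWithinAt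
  bdd := by
    have hM0 : 0 ≤ M := (abs_nonneg _).trans (hM 0)
    refine ⟨(M / k + |α + β * laplace k g| + M / k) / (2 * k), fun t ht => ?_⟩
    have h1 : |∫ s in 0..t, Real.exp (k * s) * g s| ≤ M / k * Real.exp (k * t) := by
      have hF : ∀ s ∈ uIcc 0 t, HasDerivAt (fun s => Real.exp (k * s) * (M / k))
          (Real.exp (k * s) * M) s := fun s _ =>
        ((hasDerivAt_exp_const_mul k s).mul_const (M / k)).congr_deriv (by field_simp)
      have hc : Continuous fun s => Real.exp (k * s) * M := by fun_prop
      calc |∫ s in 0..t, Real.exp (k * s) * g s| ≤ ∫ s in 0..t, Real.exp (k * s) * M := by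
            rw [← Real.norm_eq_abs]
            refine intervalIntegral.norm_integral_le_of_norm_le ht
              (Eventually.of_forall fun s _ => ?_) (hc.intervalIntegrable _ _)
            rw [norm_mul, Real.norm_eq_abs, Real.norm_eq_abs, Real.abs_exp]
            gcongr
            exact hM s
        _ = Real.exp (k * t) * (M / k) - Real.exp (k * 0) * (M / k) :=
            intervalIntegral.integral_eq_sub_of_hasDerivAt hF (hc.intervalIntegrable _ _)
        _ ≤ M / k * Real.exp (k * t) := by
            have : 0 ≤ Real.exp (k * 0) * (M / k) := by positivity
            linarith
    have h2 : |laplace k g - ∫ s in 0..t, Real.exp (-(k * s)) * g s| ≤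
        M / k * Real.exp (-(k * t)) := by
      have hb : ∀ s, ‖Real.exp (-(k * s)) * g s‖ ≤ Real.exp (-k * s) * M := fun s => by
        rw [norm_mul, Real.norm_eq_abs, Real.norm_eq_abs, Real.abs_exp, neg_mul]
        gcongr
        exact hM s
      have hi : IntegrableOn (fun s => Real.exp (-(k * s)) * g s) (Ioi 0) :=
        ((exp_neg_integrableOn_Ioi 0 hk).mul_const M).mono'
          (Continuous.aestronglyMeasurable (by fun_prop)) (Eventually.of_forall hb)
      rw [laplace, intervalIntegral.integral_of_le ht, ← setIntegral_sdiff measurableSet_Ioc hi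
        Ioc_subset_Ioi_self, Ioi_sdiff_Ioc, max_eq_right ht]
      calc |∫ s in Ioi t, Real.exp (-(k * s)) * g s| ≤ ∫ s in Ioi t, Real.exp (-k * s) * M :=
            norm_integral_le_of_norm_le ((exp_neg_integrableOn_Ioi t hk).mul_const M)
              (Eventually.of_forall hb)
        _ = (∫ s in Ioi t, Real.exp (-k * s)) * M := integral_mul_const _ _
        _ = M / k * Real.exp (-(k * t)) := by
            rw [integral_exp_mul_Ioi (neg_lt_zero.2 hk), neg_mul]
            field_simp
    rw [green, abs_div, abs_of_pos (by positivity : 0 < 2 * k)]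
    gcongr
    have e : Real.exp (k * t) * Real.exp (-(k * t)) = 1 := by
      rw [← Real.exp_add, add_neg_cancel, Real.exp_zero]
    have e' : Real.exp (-(k * t)) ≤ 1 := Real.exp_le_one_iff.2 (by nlinarith)
    refine (abs_add_le _ _).trans (add_le_add ?_ ?_)
    · rw [abs_mul, Real.abs_exp]
      calc _ ≤ Real.exp (-(k * t)) * (M / k * Real.exp (k * t) + |α + β * laplace k g|) := by
            gcongr
            exact (abs_add_le _ _).trans (by gcongr)
        _ = M / k * (Real.exp (k * t) * Real.exp (-(k * t))) +
            Real.exp (-(k * t)) * |α + β * laplace k g| := by ring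
        _ ≤ M / k * 1 + 1 * |α + β * laplace k g| := by
            rw [e]
            gcongr
        _ = _ := by ring
    · rw [abs_mul, Real.abs_exp]
      calc _ ≤ Real.exp (k * t) * (M / k * Real.exp (-(k * t))) := by gcongr
        _ = M / k * (Real.exp (k * t) * Real.exp (-(k * t))) := by ring
        _ = _ := by rw [e, mul_one]

theorem tendsto_green (hk : 0 < k) {G : ℕ → ℝ → ℝ} (hG : ∀ n, Continuous (G n))
    (hM : ∀ n t, |G n t| ≤ M) (hlim : ∀ t, Tendsto (fun n => G n t) atTop (𝓝 (g t))) (t : ℝ) :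
    Tendsto (fun n => green k α β (G n) t) atTop (𝓝 (green k α β g t)) := by
  have hP : ∀ h : ℝ → ℝ, Continuous h →
      Tendsto (fun n => ∫ s in 0..t, h s * G n s) atTop (𝓝 (∫ s in 0..t, h s * g s)) := by
    intro h hh
    refine intervalIntegral.tendsto_integral_filter_of_dominated_convergence
      (fun s => |h s| * M) (Eventually.of_forall fun n => (hh.mul (hG n)).aestronglyMeasurable)
      (Eventually.of_forall fun n => Eventually.of_forall fun s _ => ?_)
      ((hh.abs.mul continuous_const).intervalIntegrable _ _)
      (Eventually.of_forall fun s _ => (hlim s).const_mul _)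
    rw [Real.norm_eq_abs, abs_mul]
    gcongr
    exact hM n s
  have hJ : Tendsto (fun n => laplace k (G n)) atTop (𝓝 (laplace k g)) := by
    refine tendsto_integral_of_dominated_convergence (fun s => Real.exp (-k * s) * M)
      (fun n => Continuous.aestronglyMeasurable (by have := hG n; fun_prop))
      ((exp_neg_integrableOn_Ioi 0 hk).mul_const M)
      (fun n => Eventually.of_forall fun s => ?_)
      (Eventually.of_forall fun s => (hlim s).const_mul _)
    rw [Real.norm_eq_abs, abs_mul, Real.abs_exp, neg_mul]
    gcongr
    exact hM n s
  exact (((((hP _ (by fun_prop)).add ((hJ.const_mul β).const_add α)).const_mul _).add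
    ((hJ.sub (hP _ (by fun_prop))).const_mul _)).div_const _)

end

/-- The source term for which `v'' = v / (σ ρ²)` reads `v'' = k² v - srcV`, where
`y = ρ ^ 3 / 3`. -/
noncomputable def srcV (k σ v y : ℝ) : ℝ := k ^ 2 * v - v / (σ * cbrt y ^ 2)

/-- The source term for which `y'' = force` reads `y'' = k² y - srcY`, where `y = ρ ^ 3 / 3`. -/
noncomputable def srcY (k ρr j v y : ℝ) : ℝ := k ^ 2 * y - force ρr (cbrt y) (j + v)

theorem tendsto_srcV {ι : Type*} {l : Filter ι} {V Y : ι → ℝ} {k σ v y : ℝ} (hσ : 0 < σ)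
    (hy : 0 < y) (hV : Tendsto V l (𝓝 v)) (hY : Tendsto Y l (𝓝 y)) :
    Tendsto (fun i => srcV k σ (V i) (Y i)) l (𝓝 (srcV k σ v y)) := by
  have := cbrt_pos hy
  have hc := (continuous_cbrt.tendsto y).comp hY
  exact (hV.const_mul _).sub (hV.div ((hc.pow 2).const_mul σ) (by positivity))

theorem tendsto_srcY {ι : Type*} {l : Filter ι} {V Y : ι → ℝ} {k ρr j v y : ℝ}
    (hy : 0 < y) (hV : Tendsto V l (𝓝 v)) (hY : Tendsto Y l (𝓝 y)) :
    Tendsto (fun i => srcY k ρr j (V i) (Y i)) l (𝓝 (srcY k ρr j v y)) := by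
  have := cbrt_pos hy
  have hc := (continuous_cbrt.tendsto y).comp hY
  exact (hY.const_mul _).sub ((hc.sub (tendsto_const_nhds.div hc (by positivity))).add
    (((hV.const_add j).pow 2).div (hc.pow 5) (by positivity)))

theorem le_cbrt {ρ y : ℝ} (hρ : 0 ≤ ρ) (h : ρ ^ 3 / 3 ≤ y) : ρ ≤ cbrt y :=
  (cbrt_cube_div hρ).symm.trans_le (cbrt_le_cbrt (by positivity) h)

theorem cbrt_le {ρ y : ℝ} (hρ : 0 ≤ ρ) (hy : 0 ≤ y) (h : y ≤ ρ ^ 3 / 3) : cbrt y ≤ ρ :=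
  (cbrt_le_cbrt hy h).trans_eq (cbrt_cube_div hρ)

theorem srcV_mono {k σ ρj v₁ v₂ y₁ y₂ : ℝ} (hσ : 0 < σ) (h0 : 0 < ρj)
    (hk : 1 / (σ * ρj ^ 2) ≤ k ^ 2) (hv : v₁ ≤ v₂) (hv₂ : v₂ ≤ 0) (hy : y₂ ≤ y₁)
    (hy₂ : ρj ^ 3 / 3 ≤ y₂) : srcV k σ v₁ y₁ ≤ srcV k σ v₂ y₂ := by
  have hc2 := le_cbrt h0.le hy₂
  have hy0 : 0 ≤ y₂ := le_trans (by positivity) hy₂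
  have hc12 := cbrt_le_cbrt hy0 hy
  have hc0 : 0 < cbrt y₂ := h0.trans_le hc2
  have e : ∀ v y, srcV k σ v y = v * (k ^ 2 - 1 / (σ * cbrt y ^ 2)) := fun v y => by
    rw [srcV]
    ring
  have h1 : 1 / (σ * cbrt y₁ ^ 2) ≤ 1 / (σ * cbrt y₂ ^ 2) := by gcongr
  have h2 : 1 / (σ * cbrt y₂ ^ 2) ≤ k ^ 2 := le_trans (by gcongr) hk
  rw [e, e]
  calc _ ≤ v₁ * (k ^ 2 - 1 / (σ * cbrt y₂ ^ 2)) :=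
        mul_le_mul_of_nonpos_left (by linarith) (hv.trans hv₂)
    _ ≤ _ := mul_le_mul_of_nonneg_right hv (by linarith)

theorem force_sub_le {ρr ρj ρ₁ ρ₂ u : ℝ} (h0 : 0 < ρj) (h1 : ρj ≤ ρ₁) (h12 : ρ₁ ≤ ρ₂) :
    force ρr ρ₂ u - force ρr ρ₁ u ≤
      (1 + ρr ^ 2 / ρj ^ 2) / ρj ^ 2 * (ρ₂ ^ 3 / 3 - ρ₁ ^ 3 / 3) := by
  have hρ₁ : 0 < ρ₁ := h0.trans_le h1
  have hρ₂ : 0 < ρ₂ := hρ₁.trans_le h12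
  have hd : 0 ≤ ρ₂ - ρ₁ := sub_nonneg.2 h12
  have h3 : ρj ^ 2 * (ρ₂ - ρ₁) ≤ ρ₂ ^ 3 / 3 - ρ₁ ^ 3 / 3 := by
    have : ρj ^ 2 * (ρ₂ - ρ₁) ≤ ρ₁ ^ 2 * (ρ₂ - ρ₁) := by gcongr
    have : 0 ≤ (ρ₂ - ρ₁) ^ 2 * (ρ₂ + 2 * ρ₁) := by positivity
    nlinarith
  have h4 : ρr ^ 2 / ρ₁ - ρr ^ 2 / ρ₂ ≤ ρr ^ 2 / ρj ^ 2 * (ρ₂ - ρ₁) := by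
    calc ρr ^ 2 / ρ₁ - ρr ^ 2 / ρ₂ = ρr ^ 2 / (ρ₁ * ρ₂) * (ρ₂ - ρ₁) := by field_simp
      _ ≤ ρr ^ 2 / ρj ^ 2 * (ρ₂ - ρ₁) := by
        rw [sq ρj]
        have := h1.trans h12
        gcongr
  have h5 : u ^ 2 / ρ₂ ^ 5 ≤ u ^ 2 / ρ₁ ^ 5 := by gcongr
  calc force ρr ρ₂ u - force ρr ρ₁ u ≤ (1 + ρr ^ 2 / ρj ^ 2) * (ρ₂ - ρ₁) := by
        rw [force, force]
        linarith
    _ = (1 + ρr ^ 2 / ρj ^ 2) / ρj ^ 2 * (ρj ^ 2 * (ρ₂ - ρ₁)) := by field_simp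
    _ ≤ _ := by gcongr

theorem srcY_mono {k ρr ρj j v₁ v₂ y₁ y₂ : ℝ} (h0 : 0 < ρj)
    (hk : (1 + ρr ^ 2 / ρj ^ 2) / ρj ^ 2 ≤ k ^ 2) (hv : v₂ ≤ v₁) (hv₂ : -j ≤ v₂) (hy : y₁ ≤ y₂)
    (hy₁ : ρj ^ 3 / 3 ≤ y₁) : srcY k ρr j v₁ y₁ ≤ srcY k ρr j v₂ y₂ := by
  have hy0 : 0 ≤ y₁ := le_trans (by positivity) hy₁
  have hc1 := le_cbrt h0.le hy₁
  have hc12 := cbrt_le_cbrt hy0 hy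
  have hc0 : 0 < cbrt y₂ := h0.trans_le (hc1.trans hc12)
  have h := force_sub_le (ρr := ρr) (u := j + v₁) h0 hc1 hc12
  rw [cbrt_cube hy0, cbrt_cube (hy0.trans hy)] at h
  have h2 : force ρr (cbrt y₂) (j + v₂) ≤ force ρr (cbrt y₂) (j + v₁) := by
    rw [force, force]
    have : 0 ≤ j + v₂ := by linarith
    gcongr
  have h3 := mul_le_mul_of_nonneg_right hk (sub_nonneg.2 hy)
  rw [srcY, srcY]
  linarith

/-- The order interval in which the monotone iteration takes place. -/
structure Region (ρr j ρj : ℝ) (v y : ℝ → ℝ) : Prop where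
  cont_v : Continuous v
  cont_y : Continuous y
  v_ge : ∀ t, -j ≤ v t
  v_le : ∀ t, v t ≤ 0
  y_ge : ∀ t, ρj ^ 3 / 3 ≤ y t
  y_le : ∀ t, y t ≤ ρr ^ 3 / 3

/-- The solution of `z'' = k² z - srcV` with `z(0) = -j`, extended by a constant to `t < 0`. -/
noncomputable def stepV (k σ j : ℝ) (v y : ℝ → ℝ) (t : ℝ) : ℝ :=
  green k (-(2 * k * j)) (-1) (fun s => srcV k σ (v s) (y s)) (max t 0)

/-- The solution of `z'' = k² z - srcY` with `z'(0) = 0`, extended by a constant to `t < 0`. -/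
noncomputable def stepY (k ρr j : ℝ) (v y : ℝ → ℝ) (t : ℝ) : ℝ :=
  green k 0 1 (fun s => srcY k ρr j (v s) (y s)) (max t 0)

section

variable {k σ ρr j ρj : ℝ} {v y v₁ y₁ v₂ y₂ : ℝ → ℝ}

theorem srcV_mem (P : Params ρr j ρj) (hσ : 0 < σ) (hk : 1 / (σ * ρj ^ 2) ≤ k ^ 2) {v y : ℝ}
    (hv : -j ≤ v) (hv0 : v ≤ 0) (hy : ρj ^ 3 / 3 ≤ y) :
    srcV k σ v y ∈ Icc (k ^ 2 * -j) (k ^ 2 * 0) := by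
  constructor
  · have : v / (σ * cbrt y ^ 2) ≤ 0 := div_nonpos_of_nonpos_of_nonneg hv0 (by positivity)
    have : k ^ 2 * -j ≤ k ^ 2 * v := by gcongr
    rw [srcV]
    linarith
  · refine (srcV_mono hσ P.pos hk hv0 le_rfl hy le_rfl).trans_eq ?_
    simp [srcV]

theorem srcY_mem (P : Params ρr j ρj) (hk : (1 + ρr ^ 2 / ρj ^ 2) / ρj ^ 2 ≤ k ^ 2)
    {v y : ℝ} (hv : -j ≤ v) (hv0 : v ≤ 0) (hy : ρj ^ 3 / 3 ≤ y) (hy' : y ≤ ρr ^ 3 / 3) :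
    srcY k ρr j v y ∈ Icc (k ^ 2 * (ρj ^ 3 / 3)) (k ^ 2 * (ρr ^ 3 / 3)) := by
  constructor
  · refine le_trans (le_of_eq ?_) (srcY_mono (v₁ := 0) P.pos hk hv0 hv hy le_rfl)
    rw [srcY, cbrt_cube_div P.pos.le, add_zero, P.force_eq_zero, sub_zero]
  · refine (srcY_mono P.pos hk hv le_rfl hy' hy).trans_eq ?_
    have := P.pos'
    rw [srcY, cbrt_cube_div P.pos'.le, force]
    field_simp
    ring

namespace Region

theorem y_pos (P : Params ρr j ρj) (R : Region ρr j ρj v y) (t : ℝ) : 0 < y t :=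
  lt_of_lt_of_le (by have := P.pos; positivity) (R.y_ge t)

theorem continuous_srcV (P : Params ρr j ρj) (hσ : 0 < σ) (R : Region ρr j ρj v y) :
    Continuous fun s => srcV k σ (v s) (y s) :=
  continuous_iff_continuousAt.2 fun t =>
    tendsto_srcV hσ (R.y_pos P t) (R.cont_v.tendsto t) (R.cont_y.tendsto t)

theorem continuous_srcY (P : Params ρr j ρj) (R : Region ρr j ρj v y) :
    Continuous fun s => srcY k ρr j (v s) (y s) :=
  continuous_iff_continuousAt.2 fun t =>
    tendsto_srcY (R.y_pos P t) (R.cont_v.tendsto t) (R.cont_y.tendsto t)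

theorem bddSol_v (P : Params ρr j ρj) (hσ : 0 < σ) (hk0 : 0 < k) (hk : 1 / (σ * ρj ^ 2) ≤ k ^ 2)
    (R : Region ρr j ρj v y) : BddSol k (fun s => srcV k σ (v s) (y s))
      (green k (-(2 * k * j)) (-1) fun s => srcV k σ (v s) (y s))
      (greenDeriv k (-(2 * k * j)) (-1) fun s => srcV k σ (v s) (y s)) :=
  bddSol_green (M := k ^ 2 * j) hk0 (R.continuous_srcV P hσ) fun t => by
    have h := srcV_mem P hσ hk (R.v_ge t) (R.v_le t) (R.y_ge t)
    have := P.j_nonneg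
    have : 0 ≤ k ^ 2 * j := by positivity
    rw [abs_le]
    constructor <;> linarith [h.1, h.2]

theorem bddSol_y (P : Params ρr j ρj) (hk0 : 0 < k)
    (hk : (1 + ρr ^ 2 / ρj ^ 2) / ρj ^ 2 ≤ k ^ 2)
    (R : Region ρr j ρj v y) : BddSol k (fun s => srcY k ρr j (v s) (y s))
      (green k 0 1 fun s => srcY k ρr j (v s) (y s))
      (greenDeriv k 0 1 fun s => srcY k ρr j (v s) (y s)) :=
  bddSol_green (M := k ^ 2 * (ρr ^ 3 / 3)) hk0 (R.continuous_srcY P) fun t => by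
    have h := srcY_mem P hk (R.v_ge t) (R.v_le t) (R.y_ge t) (R.y_le t)
    have := P.pos
    have := P.pos'
    have : 0 ≤ k ^ 2 * (ρj ^ 3 / 3) := by positivity
    rw [abs_le]
    constructor <;> linarith [h.1, h.2]

end Region

theorem green_dirichlet (hk0 : 0 < k) (g : ℝ → ℝ) : green k (-(2 * k * j)) (-1) g 0 = -j := by
  rw [green_zero]
  field_simp
  ring

theorem Region.step (P : Params ρr j ρj) (hσ : 0 < σ) (hk0 : 0 < k)
    (hk : 1 / (σ * ρj ^ 2) ≤ k ^ 2) (hk' : (1 + ρr ^ 2 / ρj ^ 2) / ρj ^ 2 ≤ k ^ 2)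
    (R : Region ρr j ρj v y) : Region ρr j ρj (stepV k σ j v y) (stepY k ρr j v y) := by
  have BV := R.bddSol_v P hσ hk0 hk
  have BY := R.bddSol_y P hk0 hk'
  have hV := fun t => srcV_mem P hσ hk (R.v_ge t) (R.v_le t) (R.y_ge t)
  have hY := fun t => srcY_mem P hk' (R.v_ge t) (R.v_le t) (R.y_ge t) (R.y_le t)
  have hm := fun t : ℝ => le_max_right t 0
  have d0 : greenDeriv k 0 1 (fun s => srcY k ρr j (v s) (y s)) 0 = 0 := by
    simp [greenDeriv_zero]
  refine ⟨?_, ?_, fun t => ?_, fun t => ?_, fun t => ?_, fun t => ?_⟩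
  · have : Continuous (green k (-(2 * k * j)) (-1) fun s => srcV k σ (v s) (y s)) :=
      continuous_iff_continuousAt.2 fun t =>
        (hasDerivAt_green hk0 (R.continuous_srcV P hσ) t).continuousAt
    exact this.comp (continuous_id.max continuous_const)
  · have : Continuous (green k 0 1 fun s => srcY k ρr j (v s) (y s)) :=
      continuous_iff_continuousAt.2 fun t =>
        (hasDerivAt_green hk0 (R.continuous_srcY P) t).continuousAt
    exact this.comp (continuous_id.max continuous_const)
  · exact (BddSol.const k (-j)).le hk0 BV (Or.inl (green_dirichlet hk0 _).ge)
      (fun t _ => (hV t).1) (hm t)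
  · refine BV.le hk0 (BddSol.const k 0) (Or.inl ?_) (fun t _ => (hV t).2) (hm t)
    rw [green_dirichlet hk0]
    linarith [P.j_nonneg]
  · exact (BddSol.const k _).le hk0 BY (Or.inr d0.le) (fun t _ => (hY t).1) (hm t)
  · exact BY.le hk0 (BddSol.const k _) (Or.inr d0.ge) (fun t _ => (hY t).2) (hm t)

theorem Region.step_mono (P : Params ρr j ρj) (hσ : 0 < σ) (hk0 : 0 < k)
    (hk : 1 / (σ * ρj ^ 2) ≤ k ^ 2) (hk' : (1 + ρr ^ 2 / ρj ^ 2) / ρj ^ 2 ≤ k ^ 2)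
    (R₁ : Region ρr j ρj v₁ y₁) (R₂ : Region ρr j ρj v₂ y₂)
    (hv : v₁ ≤ v₂) (hy : y₂ ≤ y₁) :
    stepV k σ j v₁ y₁ ≤ stepV k σ j v₂ y₂ ∧ stepY k ρr j v₂ y₂ ≤ stepY k ρr j v₁ y₁ := by
  constructor
  · intro t
    refine (R₁.bddSol_v P hσ hk0 hk).le hk0 (R₂.bddSol_v P hσ hk0 hk) (Or.inl ?_)
      (fun t _ => srcV_mono hσ P.pos hk (hv t) (R₂.v_le t) (hy t) (R₂.y_ge t)) (le_max_right t 0)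
    rw [green_dirichlet hk0, green_dirichlet hk0]
  · intro t
    refine (R₂.bddSol_y P hk0 hk').le hk0 (R₁.bddSol_y P hk0 hk') (Or.inr ?_)
      (fun t _ => srcY_mono P.pos hk' (hv t) (R₁.v_ge t) (hy t) (R₂.y_ge t)) (le_max_right t 0)
    simp [greenDeriv_zero]

theorem Region.exists_fixed (P : Params ρr j ρj) (hσ : 0 < σ) (hk0 : 0 < k)
    (hk : 1 / (σ * ρj ^ 2) ≤ k ^ 2) (hk' : (1 + ρr ^ 2 / ρj ^ 2) / ρj ^ 2 ≤ k ^ 2) :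
    ∃ v y, Region ρr j ρj v y ∧ v = stepV k σ j v y ∧ y = stepY k ρr j v y := by
  set F : (ℝ → ℝ) × (ℝ → ℝ) → (ℝ → ℝ) × (ℝ → ℝ) :=
    fun p => (stepV k σ j p.1 p.2, stepY k ρr j p.1 p.2) with hF
  set X : ℕ → (ℝ → ℝ) × (ℝ → ℝ) := fun n => F^[n] (fun _ => -j, fun _ => ρr ^ 3 / 3) with hX
  have hXs : ∀ n, X (n + 1) = F (X n) := fun n => Function.iterate_succ_apply' _ _ _
  have hj := P.j_nonneg
  have hρ : ρj ^ 3 / 3 ≤ ρr ^ 3 / 3 := by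
    have := P.le
    have := P.pos
    gcongr
  have R : ∀ n, Region ρr j ρj (X n).1 (X n).2 := by
    intro n
    induction n with
    | zero => exact ⟨continuous_const, continuous_const, fun _ => le_rfl, fun _ => by simpa [hX],
        fun _ => hρ, fun _ => le_rfl⟩
    | succ n ih =>
      rw [hXs]
      exact ih.step P hσ hk0 hk hk'
  have hmono : ∀ n, (X n).1 ≤ (X (n + 1)).1 ∧ (X (n + 1)).2 ≤ (X n).2 := by
    intro n
    induction n with
    | zero => exact ⟨fun t => (R 1).v_ge t, fun t => (R 1).y_le t⟩
    | succ n ih =>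
      rw [hXs, hXs (n + 1)]
      exact (R n).step_mono P hσ hk0 hk hk' (R (n + 1)) ih.1 ih.2
  have hv : ∀ t, ∃ l, Tendsto (fun n => (X n).1 t) atTop (𝓝 l) := fun t =>
    ⟨_, tendsto_atTop_ciSup (monotone_nat_of_le_succ fun n => (hmono n).1 t)
      ⟨0, by rintro _ ⟨n, rfl⟩; exact (R n).v_le t⟩⟩
  have hy : ∀ t, ∃ l, Tendsto (fun n => (X n).2 t) atTop (𝓝 l) := fun t =>
    ⟨_, tendsto_atTop_ciInf (antitone_nat_of_succ_le fun n => (hmono n).2 t)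
      ⟨ρj ^ 3 / 3, by rintro _ ⟨n, rfl⟩; exact (R n).y_ge t⟩⟩
  choose v hv using hv
  choose y hy using hy
  have v_ge : ∀ t, -j ≤ v t := fun t => ge_of_tendsto' (hv t) fun n => (R n).v_ge t
  have v_le : ∀ t, v t ≤ 0 := fun t => le_of_tendsto' (hv t) fun n => (R n).v_le t
  have y_ge : ∀ t, ρj ^ 3 / 3 ≤ y t := fun t => ge_of_tendsto' (hy t) fun n => (R n).y_ge t
  have y_le : ∀ t, y t ≤ ρr ^ 3 / 3 := fun t => le_of_tendsto' (hy t) fun n => (R n).y_le t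
  have y_pos : ∀ t, 0 < y t := fun t => lt_of_lt_of_le (by have := P.pos; positivity) (y_ge t)
  have hgV : ∀ t, Tendsto (fun n => srcV k σ ((X n).1 t) ((X n).2 t)) atTop
      (𝓝 (srcV k σ (v t) (y t))) := fun t => tendsto_srcV hσ (y_pos t) (hv t) (hy t)
  have hgY : ∀ t, Tendsto (fun n => srcY k ρr j ((X n).1 t) ((X n).2 t)) atTop
      (𝓝 (srcY k ρr j (v t) (y t))) := fun t => tendsto_srcY (y_pos t) (hv t) (hy t)
  have hMV : ∀ v y : ℝ, -j ≤ v → v ≤ 0 → ρj ^ 3 / 3 ≤ y → |srcV k σ v y| ≤ k ^ 2 * j := by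
    intro v y h1 h2 h3
    have h := srcV_mem P hσ hk h1 h2 h3
    have : 0 ≤ k ^ 2 * j := by positivity
    rw [abs_le]
    constructor <;> linarith [h.1, h.2]
  have hMY : ∀ v y : ℝ, -j ≤ v → v ≤ 0 → ρj ^ 3 / 3 ≤ y → y ≤ ρr ^ 3 / 3 →
      |srcY k ρr j v y| ≤ k ^ 2 * (ρr ^ 3 / 3) := by
    intro v y h1 h2 h3 h4
    have h := srcY_mem P hk' h1 h2 h3 h4
    have := P.pos
    have := P.pos'
    have : 0 ≤ k ^ 2 * (ρj ^ 3 / 3) := by positivity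
    rw [abs_le]
    constructor <;> linarith [h.1, h.2]
  have fv : v = stepV k σ j v y := by
    funext t
    refine tendsto_nhds_unique ((hv t).comp (tendsto_add_atTop_nat 1)) ?_
    have := tendsto_green (α := -(2 * k * j)) (β := -1) hk0
      (fun n => (R n).continuous_srcV (k := k) P hσ)
      (fun n t => hMV _ _ ((R n).v_ge t) ((R n).v_le t) ((R n).y_ge t)) hgV (max t 0)
    refine this.congr fun n => ?_
    simp only [Function.comp, hXs]
    rfl
  have fy : y = stepY k ρr j v y := by
    funext t
    refine tendsto_nhds_unique ((hy t).comp (tendsto_add_atTop_nat 1)) ?_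
    have := tendsto_green (α := 0) (β := 1) hk0
      (fun n => (R n).continuous_srcY (k := k) P)
      (fun n t => hMY _ _ ((R n).v_ge t) ((R n).v_le t) ((R n).y_ge t) ((R n).y_le t)) hgY
      (max t 0)
    refine this.congr fun n => ?_
    simp only [Function.comp, hXs]
    rfl
  refine ⟨v, y, ⟨?_, ?_, v_ge, v_le, y_ge, y_le⟩, fv, fy⟩
  · rw [fv]
    refine (continuous_green (measurable_of_tendsto_metrizable
      (fun n => ((R n).continuous_srcV P hσ).measurable) (tendsto_pi_nhds.2 hgV))
      fun t => hMV _ _ (v_ge t) (v_le t) (y_ge t)).comp (continuous_id.max continuous_const)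
  · rw [fy]
    refine (continuous_green (measurable_of_tendsto_metrizable
      (fun n => ((R n).continuous_srcY P).measurable) (tendsto_pi_nhds.2 hgY))
      fun t => hMY _ _ (v_ge t) (v_le t) (y_ge t) (y_le t)).comp
      (continuous_id.max continuous_const)

theorem Profile.exists (P : Params ρr j ρj) (hσ : 0 < σ) :
    ∃ v ρ φ π, Profile ρr j ρj σ v ρ φ π := by
  have h0 := P.pos
  set A := 1 / (σ * ρj ^ 2) with hA
  set B := (1 + ρr ^ 2 / ρj ^ 2) / ρj ^ 2 with hB
  have hA0 : 0 < A := by positivity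
  have hB0 : 0 < B := by positivity
  obtain ⟨v, y, R, fv, fy⟩ := Region.exists_fixed (k := 1 + A + B) P hσ (by positivity)
    (by nlinarith) (by nlinarith)
  set k := 1 + A + B
  have hk0 : 0 < k := by positivity
  have BV := R.bddSol_v P hσ hk0 (by nlinarith)
  have BY := R.bddSol_y P hk0 (by nlinarith)
  have ev : ∀ t, 0 ≤ t → v t = green k (-(2 * k * j)) (-1) (fun s => srcV k σ (v s) (y s)) t :=
    fun t ht => by
      conv_lhs => rw [fv, stepV, max_eq_left ht]
  have ey : ∀ t, 0 ≤ t → y t = green k 0 1 (fun s => srcY k ρr j (v s) (y s)) t :=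
    fun t ht => by
      conv_lhs => rw [fy, stepY, max_eq_left ht]
  have hy0 : ∀ t, 0 ≤ y t := fun t => (R.y_pos P t).le
  refine ⟨v, fun t => cbrt (y t),
    fun t => -greenDeriv k (-(2 * k * j)) (-1) (fun s => srcV k σ (v s) (y s)) t,
    greenDeriv k 0 1 fun s => srcY k ρr j (v s) (y s), ?_⟩
  exact
  { deriv_v := (BV.deriv.congr_fun ev).congr fun t _ => neg_neg _
    deriv_φ := BV.deriv'.neg.congr fun t ht => by
      rw [← ev t ht, srcV]
      ring
    deriv_y := BY.deriv.congr_fun fun t ht => by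
      rw [cbrt_cube (hy0 t), mul_div_cancel_left₀ _ three_ne_zero, ey t ht]
    deriv_π := BY.deriv'.congr fun t ht => by
      rw [← ey t ht, srcY]
      ring
    v_zero := (ev 0 le_rfl).trans (green_dirichlet hk0 _)
    π_zero := by simp [greenDeriv_zero]
    v_ge := fun t _ => R.v_ge t
    v_le := fun t _ => R.v_le t
    ρ_ge := fun t _ => le_cbrt h0.le (R.y_ge t)
    ρ_le := fun t _ => cbrt_le P.pos'.le (hy0 t) (R.y_le t) }

end

theorem abs_sub_le_of_mem {x y B : ℝ} (hx : 0 ≤ x) (hy : 0 ≤ y) (hxB : x ≤ B) (hyB : y ≤ B) :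
    |x - y| ≤ B := by
  rw [abs_le]
  constructor <;> linarith

theorem Profile.decay {ρr j ρj σ : ℝ} {v ρ φ π : ℝ → ℝ} (P : Params ρr j ρj) (hσ : 0 < σ)
    (S : Profile ρr j ρj σ v ρ φ π) : ∃ C > 0, ∃ r > 0, ∀ t, 0 ≤ t →
      |v t| + (ρ t - ρj) + |φ t| + |π t| ≤ C * Real.exp (-(r * t)) := by
  have h0 := P.pos
  have hr := P.pos'
  have hj := P.j_nonneg
  have hρ0 : ∀ t, 0 ≤ t → 0 < ρ t := fun t ht => h0.trans_le (S.ρ_ge t ht)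
  set κ := (Real.sqrt (σ * ρr ^ 2))⁻¹ with hκ
  have hκ0 : 0 < κ := by positivity
  have hκ2 : κ ^ 2 = 1 / (σ * ρr ^ 2) := by
    rw [hκ, inv_pow, Real.sq_sqrt (by positivity), one_div]
  set κ₀ := (6 * ρj ^ 2 - 4 * ρr ^ 2) / ρr ^ 4 with hκ₀
  have hκ₀0 : 0 < κ₀ := P.forceRate_pos
  set r := min κ (min 1 (κ₀ / 2)) with hrdef
  have hr0 : 0 < r := lt_min hκ0 (lt_min one_pos (by positivity))
  have hrκ : r ≤ κ := min_le_left _ _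
  have hr1 : r ≤ 1 := (min_le_right _ _).trans (min_le_left _ _)
  have hrκ₀ : r ≤ κ₀ / 2 := (min_le_right _ _).trans (min_le_right _ _)
  have hr2 : r ^ 2 ≤ κ₀ / 2 := by nlinarith
  have hexp : ∀ k t : ℝ, HasDerivWithinAt (fun t => Real.exp (-(k * t)))
      (-(k * Real.exp (-(k * t)))) (Ici 0) t := fun k t =>
    (hasDerivAt_exp_neg_const_mul k t).hasDerivWithinAt
  have hv : ∀ t, 0 ≤ t → -v t ≤ j * Real.exp (-(r * t)) := by
    intro t ht
    have h : -v t - j * Real.exp (-(κ * t)) ≤ 0 := by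
      refine DerivIci.nonpos (b := fun t => -v t - j * Real.exp (-(κ * t)))
        (b₁ := fun t => φ t + j * κ * Real.exp (-(κ * t)))
        (b₂ := fun t => -v t / (σ * ρ t ^ 2) - j * κ ^ 2 * Real.exp (-(κ * t)))
        (fun t ht => ?_) (fun t ht => ?_) (Or.inl ?_) (fun t ht hb => ?_)
        (not_tendsto_atTop_of_le (C := j) fun t ht => ?_) ht
      · exact ((S.deriv_v t ht).neg.sub ((hexp κ t).const_mul j)).congr_deriv (by ring)
      · exact ((S.deriv_φ t ht).add ((hexp κ t).const_mul (j * κ))).congr_deriv (by ring)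
      · simp [S.v_zero]
      · have h1 : κ ^ 2 * -v t ≤ -v t / (σ * ρ t ^ 2) := by
          rw [hκ2, one_div_mul_eq_div]
          have := S.v_le t ht
          have := S.ρ_le t ht
          have := hρ0 t ht
          exact div_le_div_of_nonneg_left (by linarith) (by positivity) (by gcongr)
        have h2 : 0 < κ ^ 2 * (-v t - j * Real.exp (-(κ * t))) := by positivity
        linarith
      · have := S.v_ge t ht
        have : 0 ≤ j * Real.exp (-(κ * t)) := by positivity
        linarith
    have h2 : j * Real.exp (-(κ * t)) ≤ j * Real.exp (-(r * t)) := by gcongr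
    linarith
  set m := 2 * j ^ 2 / ρj ^ 5 with hm
  have hm0 : 0 ≤ m := by positivity
  have hfj : ∀ t, 0 ≤ t → -(m * Real.exp (-(r * t))) ≤ force ρr ρj (j + v t) ∧
      force ρr ρj (j + v t) ≤ 0 := by
    intro t ht
    have h1 := S.v_ge t ht
    have h2 := S.v_le t ht
    have e : force ρr ρj (j + v t) = -(-v t * (2 * j + v t) / ρj ^ 5) := by
      rw [← sub_zero (force ρr ρj (j + v t)), ← P.force_eq_zero, force, force]
      field_simp
      ring
    have h3 : 0 ≤ -v t * (2 * j + v t) := mul_nonneg (by linarith) (by linarith)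
    rw [e]
    constructor
    · rw [neg_le_neg_iff]
      calc -v t * (2 * j + v t) / ρj ^ 5 ≤ j * Real.exp (-(r * t)) * (2 * j) / ρj ^ 5 := by
            have := hv t ht
            gcongr
            · linarith
            · linarith
        _ = _ := by rw [hm]; ring
    · exact neg_nonpos.2 (by positivity)
  set B := ρr ^ 3 / 3 + 2 * (m + 1) / κ₀ with hB
  have hB0 : 0 < B := by positivity
  have hBm : m < B * (κ₀ - r ^ 2) := by
    have : 2 * (m + 1) / κ₀ * (κ₀ / 2) = m + 1 := by field_simp
    have : 0 ≤ ρr ^ 3 / 3 * (κ₀ / 2) := by positivity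
    have : B * (κ₀ / 2) ≤ B * (κ₀ - r ^ 2) := by gcongr; linarith
    have : B * (κ₀ / 2) = ρr ^ 3 / 3 * (κ₀ / 2) + 2 * (m + 1) / κ₀ * (κ₀ / 2) := by
      rw [hB]; ring
    linarith
  set e : ℝ → ℝ := fun t => ρ t ^ 3 / 3 - ρj ^ 3 / 3 with he
  have he0 : ∀ t, 0 ≤ t → 0 ≤ e t := fun t ht => by
    have := S.ρ_ge t ht
    have : ρj ^ 3 ≤ ρ t ^ 3 := by gcongr
    simp only [he]
    linarith
  have hee : ∀ t, 0 ≤ t → e t ≤ ρr ^ 3 / 3 := fun t ht => by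
    have := S.ρ_le t ht
    have := hρ0 t ht
    have : ρ t ^ 3 ≤ ρr ^ 3 := by gcongr
    have := pow_pos h0 3
    simp only [he]
    linarith
  have heB : ∀ t, 0 ≤ t → e t ≤ B * Real.exp (-(r * t)) := by
    intro t ht
    refine sub_nonpos.1 (DerivIci.nonpos (b := fun t => e t - B * Real.exp (-(r * t)))
        (b₁ := fun t => π t + B * r * Real.exp (-(r * t)))
        (b₂ := fun t => force ρr (ρ t) (j + v t) - B * r ^ 2 * Real.exp (-(r * t)))
        (fun t ht => ?_) (fun t ht => ?_) (Or.inl ?_) (fun t ht hb => ?_)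
        (not_tendsto_atTop_of_le (C := ρr ^ 3 / 3) fun t ht => ?_) ht)
    · exact (((S.deriv_y t ht).sub_const _).sub ((hexp r t).const_mul B)).congr_deriv (by ring)
    · exact ((S.deriv_π t ht).add ((hexp r t).const_mul (B * r))).congr_deriv (by ring)
    · have := hee 0 le_rfl
      have : 0 < 2 * (m + 1) / κ₀ := by positivity
      simp only [mul_zero, neg_zero, Real.exp_zero, mul_one, hB]
      linarith
    · have h1 := P.force_mono_left le_rfl (S.ρ_ge t ht) (S.ρ_le t ht) (u := j + v t)
        (by linarith [S.v_ge t ht]) (by linarith [S.v_le t ht])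
      have h2 := (hfj t ht).1
      have h3 : κ₀ * (B * Real.exp (-(r * t))) < κ₀ * e t :=
        mul_lt_mul_of_pos_left (sub_pos.1 hb) hκ₀0
      have h4 := mul_lt_mul_of_pos_right hBm (Real.exp_pos (-(r * t)))
      change κ₀ * e t ≤ _ at h1
      linarith
    · have := hee t ht
      have : 0 ≤ B * Real.exp (-(r * t)) := by positivity
      linarith
  set L := (1 + ρr ^ 2 / ρj ^ 2) / ρj ^ 2 with hL
  have hL0 : 0 < L := by positivity
  have hf : ∀ t, 0 ≤ t → |force ρr (ρ t) (j + v t)| ≤ (L * B + m) * Real.exp (-(r * t)) := by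
    intro t ht
    have h1 := P.force_mono_left le_rfl (S.ρ_ge t ht) (S.ρ_le t ht) (u := j + v t)
        (by linarith [S.v_ge t ht]) (by linarith [S.v_le t ht])
    have h2 := force_sub_le (ρr := ρr) (u := j + v t) h0 le_rfl (S.ρ_ge t ht)
    change κ₀ * e t ≤ _ at h1
    change _ ≤ L * e t at h2
    have h3 := hfj t ht
    have h4 := mul_le_mul_of_nonneg_left (heB t ht) hL0.le
    have h5 := mul_nonneg hκ₀0.le (he0 t ht)
    have h6 : 0 ≤ m * Real.exp (-(r * t)) := by positivity
    have h7 : 0 ≤ L * (B * Real.exp (-(r * t))) := by positivity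
    rw [abs_le]
    constructor <;> linarith
  have hE : ∀ x t, t ≤ x → Real.exp (-(r * x)) ≤ Real.exp (-(r * t)) := fun x t hxt => by
    gcongr
  refine ⟨j + B / ρj ^ 2 + (j + j / (σ * ρj ^ 2)) + (B + (L * B + m)), by positivity, r, hr0,
    fun t ht => ?_⟩
  have ht1 : 0 ≤ t + 1 := by linarith
  have hE1 := hE (t + 1) t (by linarith)
  have k1 : |v t| ≤ j * Real.exp (-(r * t)) := by
    rw [abs_of_nonpos (S.v_le t ht)]
    exact hv t ht
  have k2 : ρ t - ρj ≤ B / ρj ^ 2 * Real.exp (-(r * t)) := by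
    have h1 : ρj ^ 2 * (ρ t - ρj) ≤ e t := by
      have : 0 ≤ (ρ t - ρj) ^ 2 * (ρ t + 2 * ρj) := by
        have := hρ0 t ht
        positivity
      simp only [he]
      linarith
    rw [div_mul_eq_mul_div, le_div_iff₀ (by positivity), mul_comm]
    exact h1.trans (heB t ht)
  have k3 : |φ t| ≤ (j + j / (σ * ρj ^ 2)) * Real.exp (-(r * t)) := by
    have h := S.deriv_v.abs_deriv_le S.deriv_φ.neg ht one_pos
      (A := j / (σ * ρj ^ 2) * Real.exp (-(r * t))) (B := j * Real.exp (-(r * t)))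
      (fun x hx _ => ?_) ?_
    · rw [abs_neg] at h
      linarith
    · have hx0 := ht.trans hx
      have := hρ0 x hx0
      rw [abs_neg, abs_div, abs_neg, abs_of_nonpos (S.v_le x hx0),
        abs_of_pos (by positivity : 0 < σ * ρ x ^ 2)]
      calc -v x / (σ * ρ x ^ 2) ≤ j * Real.exp (-(r * t)) / (σ * ρj ^ 2) := by
            have h1 := S.ρ_ge x hx0
            have h2 : -v x ≤ j * Real.exp (-(r * t)) :=
              (hv x hx0).trans (mul_le_mul_of_nonneg_left (hE x t hx) hj)
            gcongr
        _ = _ := by ring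
    · rw [← neg_sub_neg]
      refine abs_sub_le_of_mem (by linarith [S.v_le t ht]) (by linarith [S.v_le _ ht1])
        (hv t ht) ((hv _ ht1).trans ?_)
      gcongr
  have k4 : |π t| ≤ (B + (L * B + m)) * Real.exp (-(r * t)) := by
    have h := S.deriv_y.abs_deriv_le S.deriv_π ht one_pos
      (A := (L * B + m) * Real.exp (-(r * t))) (B := B * Real.exp (-(r * t)))
      (fun x hx _ => ?_) ?_
    · linarith
    · refine (hf x (ht.trans hx)).trans ?_
      have := hE x t hx
      gcongr
    · rw [← sub_sub_sub_cancel_right _ _ (ρj ^ 3 / 3)]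
      refine abs_sub_le_of_mem (he0 _ ht1) (he0 _ ht) ((heB _ ht1).trans ?_) (heB t ht)
      gcongr
  linarith

/-- The change of the independent variable with density `h`. -/
structure TimeChange (h θ S : ℝ → ℝ) : Prop where
  strictMono : StrictMono S
  zero : S 0 = 0
  left_inv : ∀ t, S (θ t) = t
  nonneg : ∀ t, 0 ≤ t → 0 ≤ θ t
  tendsto : Tendsto θ atTop atTop
  deriv : ∀ t, HasDerivAt S (1 / h (S t)) t

theorem TimeChange.exists {h : ℝ → ℝ} (hc : Continuous h) {m : ℝ} (hm : 0 < m)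
    (hh : ∀ t, m ≤ h t) : ∃ θ S, TimeChange h θ S := by
  set θ : ℝ → ℝ := fun t => ∫ s in 0..t, h s with hθ
  have hd : ∀ t, HasDerivAt θ (h t) t := fun t => (hc.integral_hasStrictDerivAt 0 t).hasDerivAt
  have hcont : Continuous θ := continuous_iff_continuousAt.2 fun t => (hd t).continuousAt
  have h0 : ∀ t, 0 < h t := fun t => hm.trans_le (hh t)
  have hθ0 : θ 0 = 0 := by simp [hθ]
  have hmono : StrictMono θ := strictMono_of_hasDerivAt_pos hd h0
  have hle : ∀ a b, a ≤ b → m * (b - a) ≤ θ b - θ a := fun a b hab =>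
    mul_sub_le_image_sub_of_le_deriv (fun t => (hd t).differentiableAt)
      (fun t => by rw [(hd t).deriv]; exact hh t) hab
  have htop : Tendsto θ atTop atTop := by
    refine tendsto_atTop_mono' _ ?_ (tendsto_id.const_mul_atTop hm)
    filter_upwards [eventually_ge_atTop 0] with t ht
    have := hle 0 t ht
    simp only [id]
    linarith
  have hbot : Tendsto θ atBot atBot := by
    refine tendsto_atBot_mono' _ ?_ (tendsto_id.const_mul_atBot hm)
    filter_upwards [eventually_le_atBot 0] with t ht
    have := hle t 0 ht
    simp only [id]
    linarith
  set e := hmono.orderIsoOfSurjective θ (hcont.surjective htop hbot)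
  have hl : ∀ t, e.symm (θ t) = t := fun t => e.symm_apply_apply t
  have hr : ∀ t, θ (e.symm t) = t := fun t => e.apply_symm_apply t
  refine ⟨θ, e.symm, e.symm.strictMono, ?_, hl, fun t ht => ?_, htop,
    fun t => ?_⟩
  · conv_lhs => rw [← hθ0]
    exact hl 0
  · rw [← hθ0]
    exact hmono.monotone ht
  · rw [one_div]
    exact (hd _).of_local_left_inverse e.symm.continuous.continuousAt (h0 _).ne'
      (Eventually.of_forall hr)

theorem TimeChange.nonneg' {h θ S : ℝ → ℝ} (T : TimeChange h θ S) {t : ℝ} (ht : 0 ≤ t) :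
    0 ≤ S t := by
  rw [← T.zero]
  exact T.strictMono.monotone ht

theorem TimeChange.comp {h θ S f f' : ℝ → ℝ} (T : TimeChange h θ S) (hf : DerivIci f f') :
    DerivIci (fun t => f (S t)) fun t => f' (S t) / h (S t) := fun t ht => by
  have := (hf (S t) (T.nonneg' ht)).comp t (T.deriv t).hasDerivWithinAt
    (s' := Ici 0) (s := Ici 0) fun x hx => T.nonneg' hx
  simpa [div_eq_mul_inv, Function.comp_def] using this

theorem DerivIci.of_contDiffOn {f : ℝ → ℝ} (hf : ContDiffOn ℝ 2 f (Ici 0)) :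
    DerivIci f (derivWithin f (Ici 0)) ∧
      DerivIci (derivWithin f (Ici 0)) (derivWithin (derivWithin f (Ici 0)) (Ici 0)) := by
  have h1 : ContDiffOn ℝ 1 (derivWithin f (Ici 0)) (Ici 0) :=
    hf.derivWithin (uniqueDiffOn_Ici 0) (by norm_num)
  exact ⟨fun t ht => (hf.differentiableOn (by norm_num) t ht).hasDerivWithinAt,
    fun t ht => (h1.differentiableOn (by norm_num) t ht).hasDerivWithinAt⟩

theorem DerivIci.derivWithin_eq {f p : ℝ → ℝ} (hf : DerivIci f p) {t : ℝ} (ht : 0 ≤ t) :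
    derivWithin f (Ici 0) t = p t :=
  (hf t ht).derivWithin (uniqueDiffOn_Ici 0 t ht)

theorem DerivIci.derivWithin_derivWithin_eq {f p q : ℝ → ℝ} (hf : DerivIci f p)
    (hp : DerivIci p q) {t : ℝ} (ht : 0 ≤ t) :
    derivWithin (derivWithin f (Ici 0)) (Ici 0) t = q t :=
  (hp.congr_fun fun _ hs => hf.derivWithin_eq hs).derivWithin_eq ht

theorem DerivIci.contDiffOn {f p q : ℝ → ℝ} (hf : DerivIci f p) (hp : DerivIci p q)
    (hq : ContinuousOn q (Ici 0)) : ContDiffOn ℝ 2 f (Ici 0) := by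
  have hu := uniqueDiffOn_Ici (0 : ℝ)
  have h1 : ContDiffOn ℝ 1 p (Ici 0) := by
    rw [show (1 : WithTop ℕ∞) = 0 + 1 by norm_num, contDiffOn_succ_iff_derivWithin hu]
    exact ⟨fun t ht => (hp t ht).differentiableWithinAt, by simp, contDiffOn_zero.2
      (hq.congr fun t ht => hp.derivWithin_eq ht)⟩
  rw [show (2 : WithTop ℕ∞) = 1 + 1 by norm_num, contDiffOn_succ_iff_derivWithin hu]
  exact ⟨fun t ht => (hf t ht).differentiableWithinAt, by simp,
    h1.congr fun t ht => hf.derivWithin_eq ht⟩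

theorem not_tendsto_atTop_of_integrableOn_sq {f : ℝ → ℝ}
    (hf : IntegrableOn (fun t => f t ^ 2) (Ici 0)) : ¬ Tendsto f atTop atTop := by
  intro h
  obtain ⟨T, hT⟩ := eventually_atTop.1 (h.eventually_ge_atTop 1)
  have h1 : IntegrableOn (fun _ => (1 : ℝ)) (Ici (max T 0)) := by
    refine (hf.mono_set (Ici_subset_Ici.2 (le_max_right T 0))).mono'
      aestronglyMeasurable_const ?_
    filter_upwards [ae_restrict_mem measurableSet_Ici] with t ht
    rw [norm_one]
    exact one_le_pow₀ (hT t ((le_max_left T 0).trans ht))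
  rw [integrableOn_const_iff] at h1
  simp at h1

theorem integrableOn_sq_of_le_exp {f : ℝ → ℝ} {C r : ℝ} (hr : 0 < r) (hc : ContinuousOn f (Ici 0))
    (hf : ∀ t, 0 ≤ t → |f t| ≤ C * Real.exp (-(r * t))) :
    IntegrableOn (fun t => f t ^ 2) (Ici 0) := by
  have h1 : IntegrableOn (fun t => C ^ 2 * Real.exp (-(2 * r) * t)) (Ici 0) := by
    rw [integrableOn_Ici_iff_integrableOn_Ioi]
    exact (exp_neg_integrableOn_Ioi 0 (by positivity)).const_mul _
  refine h1.mono' ((hc.pow 2).aestronglyMeasurable measurableSet_Ici) ?_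
  filter_upwards [ae_restrict_mem measurableSet_Ici] with t ht
  rw [norm_pow, Real.norm_eq_abs]
  calc |f t| ^ 2 ≤ (C * Real.exp (-(r * t))) ^ 2 := by
        have := hf t ht
        gcongr
    _ = C ^ 2 * Real.exp (-(2 * r) * t) := by
        rw [mul_pow, ← Real.exp_nat_mul]
        push_cast
        ring_nf

theorem exists_profile_of_innerSol {ρr j ρj σ : ℝ} {ρ φ : ℝ → ℝ} (P : Params ρr j ρj) (hσ : 0 < σ)
    (h : InnerSol ρr j ρj σ ρ φ) : ∃ S v π, Profile ρr j ρj σ v (fun t => ρ (S t))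
      (fun t => φ (S t)) π ∧ S 0 = 0 ∧ DerivIci S (fun t => 1 / ρ (S t) ^ 2) ∧
      ∀ τ, 0 ≤ τ → ∃ t, 0 ≤ t ∧ S t = τ := by
  obtain ⟨cρ, cφ, eρ, eφ, p0, q0, hge, iρ, -, -, iq⟩ := h
  obtain ⟨dρ, dp⟩ := DerivIci.of_contDiffOn cρ
  obtain ⟨dφ, dq⟩ := DerivIci.of_contDiffOn cφ
  set p := derivWithin ρ (Ici 0)
  set q := derivWithin φ (Ici 0)
  have hj := P.j_nonneg
  have h0 := P.pos
  have hρ0 : ∀ t, 0 ≤ t → 0 < ρ t := fun t ht => h0.trans_le (hge t ht)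
  have hcont : Continuous fun t => ρ (max t 0) ^ 2 :=
    (dρ.continuousOn.comp_continuous (continuous_id.max continuous_const)
      fun t => le_max_right t 0).pow 2
  obtain ⟨θ, S, T⟩ := TimeChange.exists hcont (pow_pos h0 2) fun t => by
    have := hge _ (le_max_right t 0)
    gcongr
  have hS : ∀ t, 0 ≤ t → 0 ≤ S t := fun t ht => T.nonneg' ht
  have hSρ : ∀ t, 0 ≤ t → 0 < ρ (S t) := fun t ht => hρ0 _ (hS t ht)
  have hmax : ∀ t, 0 ≤ t → max (S t) 0 = S t := fun t ht => max_eq_left (hS t ht)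
  have dv : DerivIci (fun t => -σ * q (S t)) fun t => -φ (S t) := by
    refine ((T.comp dq).const_mul (-σ)).congr fun t ht => ?_
    have := eφ (S t) (hS t ht)
    have := hSρ t ht
    rw [hmax t ht]
    field_simp
    linarith
  have dφ' : DerivIci (fun t => φ (S t)) fun t => -(-σ * q (S t)) / (σ * ρ (S t) ^ 2) := by
    refine (T.comp dφ).congr fun t ht => ?_
    have := hSρ t ht
    rw [hmax t ht]
    field_simp
  have dy : DerivIci (fun t => ρ (S t) ^ 3 / 3) fun t => p (S t) := by
    have : DerivIci (fun t => ρ t ^ 3 / 3) fun t => ρ t ^ 2 * p t := fun t ht =>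
      (((dρ t ht).pow 3).div_const 3).congr_deriv (by push_cast; ring)
    refine (T.comp this).congr fun t ht => ?_
    have := hSρ t ht
    rw [hmax t ht]
    field_simp
  have dπ : DerivIci (fun t => p (S t)) fun t => force ρr (ρ (S t)) (j + -σ * q (S t)) := by
    refine (T.comp dp).congr fun t ht => ?_
    have := hSρ t ht
    rw [hmax t ht, eρ (S t) (hS t ht), force]
    field_simp
    ring
  have dS : DerivIci S fun t => 1 / ρ (S t) ^ 2 := fun t ht => by
    have := (T.deriv t).hasDerivWithinAt (s := Ici 0)
    rwa [hmax t ht] at this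
  have hback : ∀ f : ℝ → ℝ, Tendsto (fun t => f (S t)) atTop atTop → Tendsto f atTop atTop :=
    fun f hf => (hf.comp T.tendsto).congr fun t => by simp only [Function.comp, T.left_inv]
  have v0 : -σ * q (S 0) = -j := by
    rw [T.zero, q0]
    field_simp
  refine ⟨S, fun t => -σ * q (S t), fun t => p (S t), ⟨dv, dφ', dy, dπ, v0, ?_, ?_, ?_, ?_, ?_⟩,
    T.zero, dS, fun τ hτ => ⟨θ τ, T.nonneg τ hτ, T.left_inv τ⟩⟩
  · rw [T.zero, p0]
  · intro t ht
    have := (dv.neg.sub_const j).nonpos (dφ'.congr_fun fun t _ => neg_neg _)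
      (Or.inl (by linarith)) (fun s hs hb => ?_) (fun hb => ?_) ht
    · linarith
    · have := hSρ s hs
      exact div_pos (by linarith) (by positivity)
    · refine not_tendsto_atTop_of_integrableOn_sq iq ?_
      refine ((tendsto_atTop_add_const_right _ j
        (hback (fun τ => -(-σ * q τ) - j) hb)).const_mul_atTop (inv_pos.2 hσ)).congr fun τ => ?_
      field_simp
      ring
  · intro t ht
    refine dv.nonpos dφ'.neg (Or.inl (by linarith)) (fun s hs hb => ?_) (fun hb => ?_) ht
    · have := hSρ s hs
      rw [← neg_div, neg_neg]
      positivity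
    · refine not_tendsto_atTop_of_integrableOn_sq (f := fun τ => -q τ) (by simpa using iq) ?_
      refine ((hback (fun τ => -σ * q τ) hb).const_mul_atTop (inv_pos.2 hσ)).congr fun τ => ?_
      field_simp
  · exact fun t ht => hge _ (hS t ht)
  · intro t ht
    have hr := P.pos'
    have := (dy.sub_const (ρr ^ 3 / 3)).nonpos dπ (Or.inr (by rw [T.zero, p0]))
      (fun s hs hb => ?_) (fun hb => ?_) ht
    · exact le_of_pow_le_pow_left₀ three_ne_zero hr.le (by linarith)
    · have h1 : ρr < ρ (S s) := lt_of_pow_lt_pow_left₀ 3 (hSρ s hs).le (by linarith)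
      have h2 : ρr ^ 2 / ρ (S s) < ρ (S s) := by
        rw [div_lt_iff₀ (hSρ s hs)]
        nlinarith
      have h3 : 0 ≤ (j + -σ * q (S s)) ^ 2 / ρ (S s) ^ 5 :=
        div_nonneg (sq_nonneg _) (pow_nonneg (hSρ s hs).le 5)
      rw [force]
      linarith
    · refine not_tendsto_atTop_of_integrableOn_sq iρ
        (tendsto_atTop_add_const_right _ (-ρj) (tendsto_atTop.2 fun K => ?_))
      filter_upwards [(hback (fun τ => ρ τ ^ 3 / 3 - ρr ^ 3 / 3) hb).eventually_ge_atTop (K ^ 3),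
        eventually_ge_atTop 0] with τ h1 h2
      by_contra! hK
      have := hρ0 τ h2
      have : ρ τ ^ 3 ≤ K ^ 3 := by gcongr
      have : 0 < K ^ 3 := pow_pos (by linarith) 3
      have : 0 < ρr ^ 3 := by positivity
      linarith

theorem innerSol_unique {ρr j ρj σ c : ℝ} {ρ₁ φ₁ ρ₂ φ₂ : ℝ → ℝ} (P : Params ρr j ρj) (hc : j < c)
    (hcj : 2 * j * c < ρj ^ 6) (hσ0 : 0 < σ) (hσ : sigmaStar ρr j ρj c ≤ σ)
    (h₁ : InnerSol ρr j ρj σ ρ₁ φ₁) (h₂ : InnerSol ρr j ρj σ ρ₂ φ₂) {τ : ℝ} (hτ : 0 ≤ τ) :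
    ρ₁ τ = ρ₂ τ ∧ φ₁ τ = φ₂ τ := by
  obtain ⟨S₁, v₁, π₁, p₁, z₁, d₁, s₁⟩ := exists_profile_of_innerSol P hσ0 h₁
  obtain ⟨S₂, v₂, π₂, p₂, z₂, d₂, -⟩ := exists_profile_of_innerSol P hσ0 h₂
  have key : ∀ t, 0 ≤ t → v₁ t = v₂ t ∧ ρ₁ (S₁ t) = ρ₂ (S₂ t) := fun t ht =>
    Profile.unique P hc hcj hσ0 hσ p₁ p₂ ht
  have hd : DerivIci (fun t => S₁ t - S₂ t) fun _ => 0 :=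
    (d₁.sub d₂).congr fun t ht => by rw [(key t ht).2, sub_self]
  have hS : ∀ t, 0 ≤ t → S₁ t = S₂ t := fun t ht => by
    have h1 := hd.mul_sub_le (m := 0) le_rfl ht fun _ _ _ => le_rfl
    have h2 := hd.neg.mul_sub_le (m := 0) le_rfl ht fun _ _ _ => neg_zero.ge
    linarith
  obtain ⟨t, ht, rfl⟩ := s₁ τ hτ
  refine ⟨?_, ?_⟩
  · rw [(key t ht).2, hS t ht]
  · have := p₁.deriv_v.unique (p₂.deriv_v.congr_fun fun s hs => (key s hs).1) ht
    have := neg_injective this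
    simpa [hS t ht] using this

theorem exists_innerSol {ρr j ρj σ : ℝ} (P : Params ρr j ρj) (hσ : 0 < σ) :
    ∃ C > 0, ∃ r > 0, ∃ ρ φ, InnerSol ρr j ρj σ ρ φ ∧ ∀ τ, 0 ≤ τ →
      |φ τ| + |derivWithin φ (Ici 0) τ| + Real.sqrt |ρ τ ^ 2 - ρj ^ 2| +
        |derivWithin ρ (Ici 0) τ| ≤ C * Real.exp (-(r * τ)) := by
  obtain ⟨v, ρ, φ, π, p⟩ := Profile.exists P hσ
  obtain ⟨C, hC, r, hr, hdecay⟩ := p.decay P hσ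
  have h0 := P.pos
  have hr0 := P.pos'
  have hρ0 : ∀ t, 0 ≤ t → 0 < ρ t := fun t ht => h0.trans_le (p.ρ_ge t ht)
  have dρ : DerivIci ρ fun t => π t / ρ t ^ 2 := fun t ht => by
    have h1 : 0 < ρ t ^ 3 / 3 := by
      have := hρ0 t ht
      positivity
    have h2 := (hasDerivAt_cbrt h1).comp_hasDerivWithinAt t (p.deriv_y t ht)
    rw [cbrt_cube_div (hρ0 t ht).le] at h2
    refine (h2.congr_deriv (by ring)).congr (fun s hs => ?_) ?_
    · exact (cbrt_cube_div (hρ0 s hs).le).symm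
    · exact (cbrt_cube_div (hρ0 t ht).le).symm
  have hm : ∀ t : ℝ, 0 ≤ max t 0 := fun t : ℝ => le_max_right t 0
  have hcont : Continuous fun t => (ρ (max t 0) ^ 2)⁻¹ :=
    ((dρ.continuousOn.comp_continuous (continuous_id.max continuous_const) hm).pow 2).inv₀
      fun t => (pow_pos (hρ0 _ (hm t)) 2).ne'
  obtain ⟨θ, T, hT⟩ := TimeChange.exists hcont (m := (ρr ^ 2)⁻¹) (by positivity) fun t => by
    have := p.ρ_le _ (hm t)
    have := hρ0 _ (hm t)
    gcongr
  have hT0 : ∀ τ, 0 ≤ τ → 0 ≤ T τ := fun τ hτ => hT.nonneg' hτ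
  have hmax : ∀ τ, 0 ≤ τ → max (T τ) 0 = T τ := fun τ hτ => max_eq_left (hT0 τ hτ)
  have hTρ : ∀ τ, 0 ≤ τ → 0 < ρ (T τ) := fun τ hτ => hρ0 _ (hT0 τ hτ)
  have dT : DerivIci T fun τ => ρ (T τ) ^ 2 := fun τ hτ => by
    have := (hT.deriv τ).hasDerivWithinAt (s := Ici 0)
    rwa [hmax τ hτ, one_div, inv_inv] at this
  have hTle : ∀ τ, 0 ≤ τ → ρj ^ 2 * τ ≤ T τ := fun τ hτ => by
    have := dT.mul_sub_le (m := ρj ^ 2) le_rfl hτ fun x hx _ => by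
      have := p.ρ_ge _ (hT0 x hx.le)
      gcongr
    rwa [hT.zero, sub_zero, sub_zero] at this
  have dρT : DerivIci (fun τ => ρ (T τ)) fun τ => π (T τ) :=
    (hT.comp dρ).congr fun τ hτ => by
      have := hTρ τ hτ
      rw [hmax τ hτ]
      field_simp
  have dπT : DerivIci (fun τ => π (T τ)) fun τ =>
      -(ρr ^ 2 - (σ * (-v (T τ) / σ) - j) ^ 2 / ρ (T τ) ^ 4 - ρ (T τ) ^ 2) * ρ (T τ) :=
    (hT.comp p.deriv_π).congr fun τ hτ => by
      have := hTρ τ hτ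
      rw [hmax τ hτ, force]
      field_simp
      ring
  have dφT : DerivIci (fun τ => φ (T τ)) fun τ => -v (T τ) / σ :=
    (hT.comp p.deriv_φ).congr fun τ hτ => by
      have := hTρ τ hτ
      rw [hmax τ hτ]
      field_simp
  have dvT : DerivIci (fun τ => -v (T τ) / σ) fun τ => ρ (T τ) ^ 2 * φ (T τ) / σ :=
    ((hT.comp p.deriv_v).const_mul (-1 / σ)).congr_fun (fun τ _ => by ring) |>.congr
      fun τ hτ => by
        have := hTρ τ hτ
        rw [hmax τ hτ]
        field_simp
  have cρ := dρT.continuousOn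
  have cφ := dφT.continuousOn
  have cv := dvT.continuousOn
  have cπ := dπT.continuousOn
  set r' := r * ρj ^ 2 with hr'
  have hr'0 : 0 < r' := by positivity
  have hE : ∀ τ, 0 ≤ τ → C * Real.exp (-(r * T τ)) ≤ C * Real.exp (-(r' * τ)) := fun τ hτ => by
    have h1 := mul_le_mul_of_nonneg_left (hTle τ hτ) hr.le
    have h2 : r' * τ = r * (ρj ^ 2 * τ) := by rw [hr', mul_assoc]
    exact mul_le_mul_of_nonneg_left (Real.exp_le_exp.2 (by linarith)) hC.le
  have hall : ∀ τ, 0 ≤ τ → |v (T τ)| ≤ C * Real.exp (-(r' * τ)) ∧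
      |ρ (T τ) - ρj| ≤ C * Real.exp (-(r' * τ)) ∧ |φ (T τ)| ≤ C * Real.exp (-(r' * τ)) ∧
      |π (T τ)| ≤ C * Real.exp (-(r' * τ)) := fun τ hτ => by
    have h1 := (hdecay _ (hT0 τ hτ)).trans (hE τ hτ)
    have h2 := sub_nonneg.2 (p.ρ_ge _ (hT0 τ hτ))
    have h3 := abs_nonneg (v (T τ))
    have h4 := abs_nonneg (φ (T τ))
    have h5 := abs_nonneg (π (T τ))
    rw [abs_of_nonneg h2]
    refine ⟨?_, ?_, ?_, ?_⟩ <;> linarith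
  have hvσ : ∀ τ, 0 ≤ τ → |-v (T τ) / σ| ≤ C / σ * Real.exp (-(r' * τ)) := fun τ hτ => by
    rw [abs_div, abs_neg, abs_of_pos hσ, div_mul_eq_mul_div]
    have := (hall τ hτ).1
    gcongr
  refine ⟨C + C / σ + Real.sqrt (2 * ρr * C) + C, by positivity, r' / 2, by positivity,
    fun τ => ρ (T τ), fun τ => φ (T τ), ⟨?_, ?_, ?_, ?_, ?_, ?_, ?_, ?_, ?_, ?_, ?_⟩, ?_⟩
  · refine dρT.contDiffOn dπT ?_
    have : ∀ τ ∈ Ici (0 : ℝ), ρ (T τ) ^ 4 ≠ 0 := fun τ hτ => (pow_pos (hTρ τ hτ) 4).ne'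
    exact ((continuousOn_const.sub ((((continuousOn_const.mul cv).sub continuousOn_const).pow 2).div
      (cρ.pow 4) this)).sub (cρ.pow 2)).neg.mul cρ
  · exact dφT.contDiffOn dvT (((cρ.pow 2).mul cφ).div_const σ)
  · intro τ hτ
    rw [dρT.derivWithin_derivWithin_eq dπT hτ, dφT.derivWithin_eq hτ]
  · intro τ hτ
    rw [dφT.derivWithin_derivWithin_eq dvT hτ]
    field_simp
  · rw [dρT.derivWithin_eq le_rfl, hT.zero, p.π_zero]
  · rw [dφT.derivWithin_eq le_rfl, hT.zero, p.v_zero, neg_neg]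
  · exact fun τ hτ => p.ρ_ge _ (hT0 τ hτ)
  · exact integrableOn_sq_of_le_exp hr'0 (cρ.sub continuousOn_const) fun τ hτ => (hall τ hτ).2.1
  · exact (integrableOn_sq_of_le_exp hr'0 cπ fun τ hτ => (hall τ hτ).2.2.2).congr_fun
      (fun τ hτ => by rw [dρT.derivWithin_eq hτ]) measurableSet_Ici
  · exact integrableOn_sq_of_le_exp hr'0 cφ fun τ hτ => (hall τ hτ).2.2.1
  · exact (integrableOn_sq_of_le_exp hr'0 cv hvσ).congr_fun
      (fun τ hτ => by rw [dφT.derivWithin_eq hτ]) measurableSet_Ici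
  · intro τ hτ
    rw [dρT.derivWithin_eq hτ, dφT.derivWithin_eq hτ]
    have hexp : Real.exp (-(r' * τ)) ≤ Real.exp (-(r' / 2 * τ)) := by
      have := mul_nonneg hr'0.le hτ
      exact Real.exp_le_exp.2 (by linarith)
    have h1 : |φ (T τ)| ≤ C * Real.exp (-(r' / 2 * τ)) := (hall τ hτ).2.2.1.trans (by gcongr)
    have h2 : |π (T τ)| ≤ C * Real.exp (-(r' / 2 * τ)) := (hall τ hτ).2.2.2.trans (by gcongr)
    have h3 : |-v (T τ) / σ| ≤ C / σ * Real.exp (-(r' / 2 * τ)) := (hvσ τ hτ).trans (by gcongr)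
    have h4 : Real.sqrt |ρ (T τ) ^ 2 - ρj ^ 2| ≤
        Real.sqrt (2 * ρr * C) * Real.exp (-(r' / 2 * τ)) := by
      rw [Real.sqrt_le_left (by positivity), mul_pow, Real.sq_sqrt (by positivity),
        ← Real.exp_nat_mul]
      calc |ρ (T τ) ^ 2 - ρj ^ 2| = |ρ (T τ) + ρj| * |ρ (T τ) - ρj| := by
            rw [← abs_mul]
            ring_nf
        _ ≤ 2 * ρr * (C * Real.exp (-(r' * τ))) := by
            gcongr
            · rw [abs_of_pos (add_pos (hTρ τ hτ) h0)]
              have := p.ρ_le _ (hT0 τ hτ)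
              have := P.le
              linarith
            · exact (hall τ hτ).2.1
        _ = _ := by
            push_cast
            ring_nf
    linarith

theorem innerSol_neg {ρr j ρj σ : ℝ} {ρ φ : ℝ → ℝ} (h : InnerSol ρr j ρj σ ρ φ) :
    InnerSol ρr (-j) ρj σ ρ fun τ => -φ τ := by
  obtain ⟨cρ, cφ, eρ, eφ, p0, q0, hge, iρ, ip, iφ, iq⟩ := h
  have d1 : derivWithin (fun τ => -φ τ) (Ici 0) = fun τ => -derivWithin φ (Ici 0) τ := by
    funext τ
    exact derivWithin.fun_neg
  have d2 : derivWithin (fun τ => -derivWithin φ (Ici 0) τ) (Ici 0) =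
      fun τ => -derivWithin (derivWithin φ (Ici 0)) (Ici 0) τ := by
    funext τ
    exact derivWithin.fun_neg
  refine ⟨cρ, cφ.neg, fun τ hτ => ?_, fun τ hτ => ?_, p0, ?_, hge, iρ, ip, ?_, ?_⟩
  · rw [eρ τ hτ, d1]
    ring
  · rw [d1, d2]
    linarith [eφ τ hτ]
  · simp only [d1, q0, neg_div]
  · simpa using iφ
  · simpa [d1] using iq

theorem exists_unique_innerSol {ρr j ρj : ℝ} (P : Params ρr j ρj) :
    ∃ σstar > 0, ∀ σ ≥ σstar, ∃ C > 0, ∃ γ > 0, ∃ ρ φ : ℝ → ℝ, InnerSol ρr j ρj σ ρ φ ∧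
      (∀ τ ≥ 0, |φ τ| + |derivWithin φ (Ici 0) τ| + Real.sqrt |ρ τ ^ 2 - ρj ^ 2| +
        |derivWithin ρ (Ici 0) τ| ≤ C * Real.exp (-γ * (Real.sqrt σ)⁻¹ * τ)) ∧
      ∀ ρ' φ' : ℝ → ℝ, InnerSol ρr j ρj σ ρ' φ' → ∀ τ ≥ 0, ρ' τ = ρ τ ∧ φ' τ = φ τ := by
  have h0 := P.pos
  have hj := P.j_nonneg
  have hj2 : 2 * j ^ 2 < ρj ^ 6 := by
    have h1 := P.eq
    have h2 := mul_lt_mul_of_pos_left P.lt (pow_pos h0 4)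
    linarith
  set δ := (ρj ^ 6 - 2 * j ^ 2) / (2 * j + 1) with hδ
  have hδ0 : 0 < δ := div_pos (by linarith) (by linarith)
  have hδe : δ * (2 * j + 1) = ρj ^ 6 - 2 * j ^ 2 := div_mul_cancel₀ _ (by linarith)
  refine ⟨max 1 (sigmaStar ρr j ρj (j + δ)), by positivity, fun σ hσ => ?_⟩
  have hσ0 : 0 < σ := one_pos.trans_le ((le_max_left _ _).trans hσ)
  obtain ⟨C, hC, r, hr, ρ, φ, hsol, hdecay⟩ := exists_innerSol P hσ0
  refine ⟨C, hC, r * Real.sqrt σ, by positivity, ρ, φ, hsol, fun τ hτ => ?_,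
    fun ρ' φ' h' τ hτ => innerSol_unique P (c := j + δ) (by linarith) (by linarith) hσ0
      ((le_max_right _ _).trans hσ) h' hsol hτ⟩
  have e : -(r * Real.sqrt σ) * (Real.sqrt σ)⁻¹ * τ = -(r * τ) := by
    field_simp
  rw [e]
  exact hdecay τ hτ

end InnerProblem

/-- Lemma 2.2 of the paper: for `ρ_r ∈ (0,1]`, `j² < (4/27)ρ_r⁶` and `ρ_j` the root of
`ρ_j⁴(ρ_r² - ρ_j²) = j²` in `(√(2/3)ρ_r, ρ_r]`, there is `σ* > 0` such that for every
`σ₀ ≥ σ*` the inner problem has a unique solution `(ρ, φ)` in the class `InnerSol`,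
which moreover decays like `C·e^{-γσ₀^{-1/2}τ}`. -/
theorem inner_problem_existence_uniqueness (ρr j ρj : ℝ)
    (hρr : ρr ∈ Set.Ioc (0 : ℝ) 1) (hj : j ^ 2 < 4 / 27 * ρr ^ 6)
    (hρj : ρj ∈ Set.Ioc (Real.sqrt (2 / 3) * ρr) ρr ∧
      ρj ^ 4 * (ρr ^ 2 - ρj ^ 2) = j ^ 2) :
    ∃ σstar > (0 : ℝ), ∀ σ₀ ≥ σstar,
      ∃ C > (0 : ℝ), ∃ γ > (0 : ℝ), ∃ ρ φ : ℝ → ℝ,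
        InnerSol ρr j ρj σ₀ ρ φ ∧
        (∀ τ ≥ (0 : ℝ),
          |φ τ| + |derivWithin φ (Set.Ici (0 : ℝ)) τ| +
              Real.sqrt |(ρ τ) ^ 2 - ρj ^ 2| + |derivWithin ρ (Set.Ici (0 : ℝ)) τ| ≤
            C * Real.exp (-γ * (Real.sqrt σ₀)⁻¹ * τ)) ∧
        (∀ ρ' φ' : ℝ → ℝ, InnerSol ρr j ρj σ₀ ρ' φ' →
          ∀ τ ≥ (0 : ℝ), ρ' τ = ρ τ ∧ φ' τ = φ τ) := by
  obtain ⟨⟨hlt, hle⟩, heq⟩ := hρj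
  have hρr0 : 0 < ρr := hρr.1
  have hpos : 0 < ρj := lt_of_le_of_lt (by positivity) hlt
  have hlt2 : 2 * ρr ^ 2 < 3 * ρj ^ 2 := by
    have h := pow_lt_pow_left₀ hlt (by positivity) two_ne_zero
    rw [mul_pow, Real.sq_sqrt (by norm_num)] at h
    linarith
  rcases le_total 0 j with hj0 | hj0
  · exact InnerProblem.exists_unique_innerSol ⟨hj0, hpos, hle, heq.symm, hlt2⟩
  · obtain ⟨σstar, hσs, H⟩ := InnerProblem.exists_unique_innerSol (j := -j)
      ⟨neg_nonneg.2 hj0, hpos, hle, by rw [neg_sq, heq], hlt2⟩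
    refine ⟨σstar, hσs, fun σ₀ hσ => ?_⟩
    obtain ⟨C, hC, γ, hγ, ρ, φ, hsol, hdecay, huniq⟩ := H σ₀ hσ
    refine ⟨C, hC, γ, hγ, ρ, fun τ => -φ τ, by simpa using InnerProblem.innerSol_neg hsol,
      fun τ hτ => ?_, fun ρ' φ' h' τ hτ => ?_⟩
    · rw [derivWithin.fun_neg, abs_neg, abs_neg]
      exact hdecay τ hτ
    · have := huniq ρ' _ (InnerProblem.innerSol_neg h') τ hτ
      exact ⟨this.1, by linarith [this.2]⟩
end

section
/- Let 0 < β < 1, γ > 0, σ > 0, and let A ∈ ℝ satisfy γ²·A − 2βγ + ((1 − β²)/σ)·(A − 2β/γ) = (γ² − 2Aβγ + 2(1 − β²))·A. Set λ := γ² − 2Aβγ + 2(1 − β²) ∈ ℝ, and define the complex-valued functions v(x) := sin(γx) + i·A·cos(γx) and φ(x) := (√(1 − β²)/σ)·(A − 2β/γ)·cos(γx) on ℝ. Then for every x ∈ ℝ: (i) −v''(x) − 2iβ·v'(x) + 2(1 − β²)·Re(v(x)) + i·√(1 − β²)·φ(x) = λ·v(x); and (ii) −σ·φ'(x) + 2β·√(1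 − β²)·Re(v(x)) + √(1 − β²)·(Im v)'(x) = 0. -/
/-- The eigenfunction ansatz `v(x) = sin(γx) + iA cos(γx)`. -/
noncomputable def vAnsatz (γ A : ℝ) (x : ℝ) : ℂ :=
  (Real.sin (γ * x) : ℂ) + Complex.I * (A : ℂ) * (Real.cos (γ * x) : ℂ)

/-- The associated potential `φ(x) = (√(1-β²)/σ)(A - 2β/γ)cos(γx)`. -/
noncomputable def φAnsatz (β γ σ A : ℝ) (x : ℝ) : ℝ :=
  (Real.sqrt (1 - β ^ 2) / σ) * (A - 2 * β / γ) * Real.cos (γ * x)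

theorem hasDerivAt_sin_cos_combination (γ : ℝ) (a b : ℂ) (x : ℝ) :
    HasDerivAt (fun y : ℝ => a * (Real.sin (γ * y) : ℂ) + b * (Real.cos (γ * y) : ℂ))
      (-(b * γ) * (Real.sin (γ * x) : ℂ) + a * γ * (Real.cos (γ * x) : ℂ)) x := by
  have hlin : HasDerivAt (fun y : ℝ => γ * y) γ x := by
    simpa using (hasDerivAt_id x).const_mul γ
  refine ((hlin.sin.ofReal_comp.const_mul a).add
    (hlin.cos.ofReal_comp.const_mul b)).congr_deriv ?_
  push_cast
  ring

theorem hasDerivAt_const_mul_cos (γ c x : ℝ) :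
    HasDerivAt (fun y : ℝ => c * Real.cos (γ * y)) (-(c * γ * Real.sin (γ * x))) x := by
  have hlin : HasDerivAt (fun y : ℝ => γ * y) γ x := by
    simpa using (hasDerivAt_id x).const_mul γ
  exact (hlin.cos.const_mul c).congr_deriv (by ring)

theorem deriv_vAnsatz (γ A : ℝ) :
    deriv (vAnsatz γ A) = fun x : ℝ =>
      -(Complex.I * A * γ) * (Real.sin (γ * x) : ℂ) + (γ : ℂ) * (Real.cos (γ * x) : ℂ) := by
  funext x
  have h := (hasDerivAt_sin_cos_combination γ 1 (Complex.I * A) x).deriv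
  simp only [one_mul] at h
  exact h

theorem deriv_deriv_vAnsatz (γ A x : ℝ) :
    deriv (deriv (vAnsatz γ A)) x = -(γ : ℂ) ^ 2 * vAnsatz γ A x := by
  rw [deriv_vAnsatz, (hasDerivAt_sin_cos_combination γ _ _ x).deriv, vAnsatz]
  ring

theorem vAnsatz_re (γ A x : ℝ) : (vAnsatz γ A x).re = Real.sin (γ * x) := by
  simp [vAnsatz, -Complex.ofReal_sin, -Complex.ofReal_cos]

theorem vAnsatz_im (γ A x : ℝ) : (vAnsatz γ A x).im = A * Real.cos (γ * x) := by
  simp [vAnsatz, -Complex.ofReal_sin, -Complex.ofReal_cos]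

theorem deriv_φAnsatz (β γ σ A x : ℝ) :
    deriv (φAnsatz β γ σ A) x =
      -(Real.sqrt (1 - β ^ 2) / σ * (A - 2 * β / γ) * γ * Real.sin (γ * x)) :=
  (hasDerivAt_const_mul_cos γ _ x).deriv

/-- Verification of the eigenfunction ansatz for the linearized one-dimensional
reduced Ginzburg–Landau operator: if `A` satisfies the compatibility equation, then
with `λ = γ² - 2Aβγ + 2(1-β²)`, `v` and `φ` satisfy
`-v'' - 2iβv' + 2(1-β²)Re(v) + i√(1-β²)φ = λv` and
`-σφ' + 2β√(1-β²)Re(v) + √(1-β²)(Im v)' = 0`. -/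
theorem eigenfunction_ansatz_verification (β γ σ A : ℝ)
    (hβ0 : 0 < β) (hβ1 : β < 1) (hγ : 0 < γ) (hσ : 0 < σ)
    (hA : γ ^ 2 * A - 2 * β * γ + ((1 - β ^ 2) / σ) * (A - 2 * β / γ) =
      (γ ^ 2 - 2 * A * β * γ + 2 * (1 - β ^ 2)) * A) :
    ∀ x : ℝ,
      (-(deriv (deriv (vAnsatz γ A)) x) -
          2 * Complex.I * (β : ℂ) * deriv (vAnsatz γ A) x +
          2 * ((1 : ℂ) - (β : ℂ) ^ 2) * ((vAnsatz γ A x).re : ℂ) +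
          Complex.I * (Real.sqrt (1 - β ^ 2) : ℂ) * (φAnsatz β γ σ A x : ℂ) =
        ((γ ^ 2 - 2 * A * β * γ + 2 * (1 - β ^ 2) : ℝ) : ℂ) * vAnsatz γ A x) ∧
      (-σ * deriv (φAnsatz β γ σ A) x +
          2 * β * Real.sqrt (1 - β ^ 2) * (vAnsatz γ A x).re +
          Real.sqrt (1 - β ^ 2) * deriv (fun y => (vAnsatz γ A y).im) x = 0) := by
  intro x
  constructor
  · have hsqrt : (Real.sqrt (1 - β ^ 2) : ℂ) ^ 2 = 1 - (β : ℂ) ^ 2 := by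
      exact_mod_cast Real.sq_sqrt (by nlinarith : 0 ≤ 1 - β ^ 2)
    have hAc : (γ : ℂ) ^ 2 * A - 2 * β * γ + ((1 - β ^ 2) / σ) * (A - 2 * β / γ) =
        (γ ^ 2 - 2 * A * β * γ + 2 * (1 - β ^ 2)) * A := by
      exact_mod_cast hA
    rw [deriv_deriv_vAnsatz, deriv_vAnsatz, vAnsatz_re, vAnsatz, φAnsatz]
    simp only [Complex.ofReal_mul, Complex.ofReal_div, Complex.ofReal_sub, Complex.ofReal_add,
      Complex.ofReal_pow, Complex.ofReal_one, Complex.ofReal_ofNat]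
    linear_combination Complex.I * (Real.cos (γ * x) : ℂ) * hAc +
      2 * β * A * γ * (Real.sin (γ * x) : ℂ) * Complex.I_sq +
      Complex.I * (A - 2 * β / γ) / σ * (Real.cos (γ * x) : ℂ) * hsqrt
  · simp only [vAnsatz_im]
    rw [deriv_φAnsatz, vAnsatz_re, (hasDerivAt_const_mul_cos γ A x).deriv]
    field_simp
    ring
end

section
/- Let 0 < β < 1, γ > 0, σ > 0. Define A_± := [(1 − β²)(1 − 1/(2σ)) ± √((1 − β²)²(1 − 1/(2σ))² + 4β²(γ² + (1 − β²)/σ))]/(2βγ) and λ_± := γ² + (1 − β²)(1 + 1/(2σ)) ± √((1 − β²)²(1 − 1/(2σ))² + 4β²(γ² + (1 − β²)/σ)). Then a real number A satisfies the compatibility equation γ²·A − 2βγ + ((1 − β²)/σ)·(A − 2β/γ) = (γ² − 2Aβγ + 2(1 − β²))·A if and only if A = A₊ or A = A₋; moreover γ² − 2A₊βγ + 2(1 − β²) = λ₋ and γ² − 2A₋βγ + 2(1 − β²) = λ₊. -/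
/-- The discriminant `(1-β²)²(1-1/(2σ))² + 4β²(γ² + (1-β²)/σ)`. -/
noncomputable def discr (β γ σ : ℝ) : ℝ :=
  (1 - β ^ 2) ^ 2 * (1 - 1 / (2 * σ)) ^ 2 + 4 * β ^ 2 * (γ ^ 2 + (1 - β ^ 2) / σ)

/-- The amplitude `A₊` from eq. (135). -/
noncomputable def Aplus (β γ σ : ℝ) : ℝ :=
  ((1 - β ^ 2) * (1 - 1 / (2 * σ)) + Real.sqrt (discr β γ σ)) / (2 * β * γ)

/-- The amplitude `A₋` from eq. (135). -/
noncomputable def Aminus (β γ σ : ℝ) : ℝ :=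
  ((1 - β ^ 2) * (1 - 1 / (2 * σ)) - Real.sqrt (discr β γ σ)) / (2 * β * γ)

/-- The eigenvalue `λ₊` from eq. (136). -/
noncomputable def lamPlus (β γ σ : ℝ) : ℝ :=
  γ ^ 2 + (1 - β ^ 2) * (1 + 1 / (2 * σ)) + Real.sqrt (discr β γ σ)

/-- The eigenvalue `λ₋` from eq. (136). -/
noncomputable def lamMinus (β γ σ : ℝ) : ℝ :=
  γ ^ 2 + (1 - β ^ 2) * (1 + 1 / (2 * σ)) - Real.sqrt (discr β γ σ)

lemma discr_nonneg {β γ σ : ℝ} (hβ : β ^ 2 ≤ 1) (hσ : 0 ≤ σ) : 0 ≤ discr β γ σ := by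
  have : 0 ≤ 1 - β ^ 2 := sub_nonneg.mpr hβ
  unfold discr
  positivity

/-- Completing the square in the compatibility equation. -/
lemma compatibility_iff_sq_eq_discr {β γ σ : ℝ} (hβ : β ≠ 0) (hγ : γ ≠ 0) (hσ : σ ≠ 0) (A : ℝ) :
    γ ^ 2 * A - 2 * β * γ + ((1 - β ^ 2) / σ) * (A - 2 * β / γ) =
        (γ ^ 2 - 2 * A * β * γ + 2 * (1 - β ^ 2)) * A ↔
      (A * (2 * β * γ) - (1 - β ^ 2) * (1 - 1 / (2 * σ))) ^ 2 = discr β γ σ := by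
  have key : 2 * β * γ * (γ ^ 2 * A - 2 * β * γ + ((1 - β ^ 2) / σ) * (A - 2 * β / γ) -
        (γ ^ 2 - 2 * A * β * γ + 2 * (1 - β ^ 2)) * A) =
      (A * (2 * β * γ) - (1 - β ^ 2) * (1 - 1 / (2 * σ))) ^ 2 - discr β γ σ := by
    unfold discr
    field_simp
    ring
  have hβγ : 2 * β * γ ≠ 0 := by simp [hβ, hγ]
  rw [← sub_eq_zero, ← mul_eq_zero_iff_left hβγ, key, sub_eq_zero]

/-- `A` solves the compatibility equation iff `A = A₊` or `A = A₋`; moreover the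
corresponding eigenvalues are `λ₋` and `λ₊` respectively. -/
theorem amplitudes_and_eigenvalues (β γ σ : ℝ)
    (hβ0 : 0 < β) (hβ1 : β < 1) (hγ : 0 < γ) (hσ : 0 < σ) :
    (∀ A : ℝ,
      γ ^ 2 * A - 2 * β * γ + ((1 - β ^ 2) / σ) * (A - 2 * β / γ) =
          (γ ^ 2 - 2 * A * β * γ + 2 * (1 - β ^ 2)) * A ↔
        A = Aplus β γ σ ∨ A = Aminus β γ σ) ∧
    γ ^ 2 - 2 * Aplus β γ σ * β * γ + 2 * (1 - β ^ 2) = lamMinus β γ σ ∧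
    γ ^ 2 - 2 * Aminus β γ σ * β * γ + 2 * (1 - β ^ 2) = lamPlus β γ σ := by
  have hβγ : 2 * β * γ ≠ 0 := by positivity
  have hplus : Aplus β γ σ * (2 * β * γ) =
      (1 - β ^ 2) * (1 - 1 / (2 * σ)) + √(discr β γ σ) := div_mul_cancel₀ _ hβγ
  have hminus : Aminus β γ σ * (2 * β * γ) =
      (1 - β ^ 2) * (1 - 1 / (2 * σ)) - √(discr β γ σ) := div_mul_cancel₀ _ hβγ
  refine ⟨fun A ↦ ?_, ?_, ?_⟩
  · have hdiscr : 0 ≤ discr β γ σ := discr_nonneg (by nlinarith) hσ.le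
    rw [compatibility_iff_sq_eq_discr hβ0.ne' hγ.ne' hσ.ne', ← Real.sq_sqrt hdiscr,
      sq_eq_sq_iff_eq_or_eq_neg, sub_eq_iff_eq_add', sub_eq_iff_eq_add', ← sub_eq_add_neg,
      ← hplus, ← hminus, mul_left_inj' hβγ, mul_left_inj' hβγ]
  · unfold lamMinus
    linear_combination -hplus
  · unfold lamPlus
    linear_combination -hminus
end
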